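/- arXiv:1302.1157 — 4 statements merged into one kernel-verified Lean document; each statement's English description precedes it below -/
import Mathlib

section
/- Mean-square convergence of the diffusion strategy (Theorem 1, part 1): Assume the diffusion learning model, and assume the step-size sequence satisfies μ(i) > 0 for all i, ∑_{i=1}^∞ μ(i) = ∞, and μ(i) → 0 as i → ∞. Then for every node k ∈ {1,…,N}, the mean-square error converges to zero: E‖w° − w_{k,i}‖² → 0 as i → ∞. -/
open MeasureTheory Filter Topology RealInnerProductSpace

section Helpers

variable {E : Type*} [NormedAddCommGroup E] [InnerProductSpace ℝ E] [CompleteSpace E]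

lemma diffu_contDiff_gradient {J : E → ℝ} (hJ : ContDiff ℝ 2 J) : ContDiff ℝ 1 (gradient J) := by
  have h1 : ContDiff ℝ 1 (fderiv ℝ J) := hJ.fderiv_right (by norm_num)
  exact (InnerProductSpace.toDual ℝ E).symm.contDiff.comp h1

lemma diffu_inner_hess {J : E → ℝ} (hJ : ContDiff ℝ 2 J) (x u v : E) :
    ⟪u, fderiv ℝ (gradient J) x v⟫ = fderiv ℝ (fderiv ℝ J) x v u := by
  have h1 : ContDiff ℝ 1 (fderiv ℝ J) := hJ.fderiv_right (by norm_num)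
  have hd : HasFDerivAt (fderiv ℝ J) (fderiv ℝ (fderiv ℝ J) x) x :=
    (h1.differentiable (by norm_num) x).hasFDerivAt
  have hg : HasFDerivAt (gradient J) _ x :=
    ((InnerProductSpace.toDual ℝ E).symm.toContinuousLinearEquiv.hasFDerivAt
      (x := fderiv ℝ J x)).comp x hd
  rw [hg.fderiv, real_inner_comm]
  exact InnerProductSpace.toDual_symm_apply (𝕜 := ℝ)

lemma diffu_hess_norm {J : E → ℝ} (hJ : ContDiff ℝ 2 J) {lmin lmax : ℝ} (hlmin : 0 < lmin)
    (hlle : lmin ≤ lmax)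
    (hHess : ∀ x v : E,
      lmin * ‖v‖ ^ 2 ≤ ⟪v, fderiv ℝ (gradient J) x v⟫ ∧
      ⟪v, fderiv ℝ (gradient J) x v⟫ ≤ lmax * ‖v‖ ^ 2) (x : E) :
    ‖fderiv ℝ (gradient J) x‖ ≤ lmax := by
  refine ContinuousLinearMap.opNorm_le_bound _ (by linarith) fun v => ?_
  set H := fderiv ℝ (gradient J) x with hH
  have hsymm : ∀ u v : E, ⟪u, H v⟫ = ⟪v, H u⟫ := by
    intro u v
    rw [hH, diffu_inner_hess hJ, diffu_inner_hess hJ]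
    exact (hJ.contDiffAt (x := x)).isSymmSndFDerivAt (by simp) v u
  have key : ∀ u v : E, 4 * ⟪u, H v⟫ ≤ lmax * ‖u + v‖ ^ 2 := by
    intro u v
    have h1 := (hHess x (u + v)).2
    have h2 := (hHess x (u - v)).1
    rw [← hH] at h1 h2
    simp only [map_add, map_sub, inner_add_left, inner_add_right, inner_sub_left,
      inner_sub_right] at h1 h2
    have := hsymm u v
    have h3 : 0 ≤ lmin * ‖u - v‖ ^ 2 := by positivity
    linarith
  by_cases hv : ‖H v‖ = 0
  · rw [hv]; exact mul_nonneg (by linarith) (norm_nonneg _)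
  have hHv : 0 < ‖H v‖ := lt_of_le_of_ne (norm_nonneg _) (Ne.symm hv)
  have hvp : 0 < ‖v‖ := by
    rw [norm_pos_iff]; rintro rfl; simp at hv
  have h := key ((‖v‖ / ‖H v‖) • H v) v
  rw [real_inner_smul_left, real_inner_self_eq_norm_sq] at h
  have hn : ‖(‖v‖ / ‖H v‖) • H v + v‖ ≤ 2 * ‖v‖ := by
    refine (norm_add_le _ _).trans ?_
    rw [norm_smul, Real.norm_of_nonneg (by positivity), div_mul_cancel₀ _ hv]
    linarith
  have hn2 : ‖(‖v‖ / ‖H v‖) • H v + v‖ ^ 2 ≤ (2 * ‖v‖) ^ 2 := by gcongr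
  have e1 : ‖v‖ / ‖H v‖ * ‖H v‖ ^ 2 = ‖v‖ * ‖H v‖ := by field_simp
  rw [e1] at h
  have h4 : lmax * ‖(‖v‖ / ‖H v‖) • H v + v‖ ^ 2 ≤ lmax * (2 * ‖v‖) ^ 2 :=
    mul_le_mul_of_nonneg_left hn2 (by linarith)
  have h5 : ‖v‖ * ‖H v‖ ≤ ‖v‖ * (lmax * ‖v‖) := by nlinarith
  exact le_of_mul_le_mul_left h5 hvp

lemma diffu_lip {J : E → ℝ} (hJ : ContDiff ℝ 2 J) {lmin lmax : ℝ} (hlmin : 0 < lmin)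
    (hlle : lmin ≤ lmax)
    (hHess : ∀ x v : E,
      lmin * ‖v‖ ^ 2 ≤ ⟪v, fderiv ℝ (gradient J) x v⟫ ∧
      ⟪v, fderiv ℝ (gradient J) x v⟫ ≤ lmax * ‖v‖ ^ 2) (wo x : E) (hwo : gradient J wo = 0) :
    ‖gradient J x‖ ≤ lmax * ‖wo - x‖ := by
  have h := convex_univ.norm_image_sub_le_of_norm_fderiv_le (𝕜 := ℝ) (f := gradient J)
    (fun y _ => (diffu_contDiff_gradient hJ).differentiable (by norm_num) y)
    (fun y _ => diffu_hess_norm hJ hlmin hlle hHess y) (Set.mem_univ wo) (Set.mem_univ x)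
  rwa [hwo, sub_zero, norm_sub_rev] at h

lemma diffu_mono {J : E → ℝ} (hJ : ContDiff ℝ 2 J) {lmin lmax : ℝ}
    (hHess : ∀ x v : E,
      lmin * ‖v‖ ^ 2 ≤ ⟪v, fderiv ℝ (gradient J) x v⟫ ∧
      ⟪v, fderiv ℝ (gradient J) x v⟫ ≤ lmax * ‖v‖ ^ 2) (wo x : E) (hwo : gradient J wo = 0) :
    ⟪wo - x, gradient J x⟫ ≤ - (lmin * ‖wo - x‖ ^ 2) := by
  set d := x - wo with hd
  have hder : ∀ t : ℝ, HasDerivAt (fun t : ℝ => ⟪d, gradient J (wo + t • d)⟫)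
      ⟪d, fderiv ℝ (gradient J) (wo + t • d) d⟫ t := by
    intro t
    have h1 : HasDerivAt (fun t : ℝ => wo + t • d) d t := by
      simpa using ((hasDerivAt_id t).smul_const d).const_add wo
    have h2 := ((diffu_contDiff_gradient hJ).differentiable (by norm_num)
      (wo + t • d)).hasFDerivAt.comp_hasDerivAt t h1
    simpa using (hasDerivAt_const t d).inner ℝ h2
  have h := mul_sub_le_image_sub_of_le_deriv (f := fun t : ℝ => ⟪d, gradient J (wo + t • d)⟫)
    (fun t => (hder t).differentiableAt) (C := lmin * ‖d‖ ^ 2)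
    (fun t => by rw [(hder t).deriv]; exact (hHess _ d).1) (show (0:ℝ) ≤ 1 by norm_num)
  have e : wo + d = x := by rw [hd]; abel
  simp only [one_smul, zero_smul, add_zero, hwo, inner_zero_right, e, sub_zero, mul_one] at h
  have e2 : wo - x = -d := by rw [hd]; abel
  rw [e2, inner_neg_left, norm_neg]
  linarith

lemma diffu_G {g : E → E} {lmin lmax : ℝ} {wo x : E} (s : ℝ) (hs : 0 ≤ s)
    (hlip : ‖g x‖ ≤ lmax * ‖wo - x‖)
    (hmono : ⟪wo - x, g x⟫ ≤ - (lmin * ‖wo - x‖ ^ 2)) :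
    ‖(wo - x) + s • g x‖ ^ 2 ≤ (1 - 2 * s * lmin + s ^ 2 * lmax ^ 2) * ‖wo - x‖ ^ 2 := by
  rw [norm_add_sq_real, norm_smul, real_inner_smul_right, Real.norm_of_nonneg hs]
  have h1 : ‖g x‖ ^ 2 ≤ (lmax * ‖wo - x‖) ^ 2 := by gcongr
  have h2 := mul_le_mul_of_nonneg_left h1 (sq_nonneg s)
  have h3 := mul_le_mul_of_nonneg_left hmono hs
  nlinarith

lemma diffu_step {Ω : Type*} {m m0 : MeasurableSpace Ω} (P : Measure Ω) [IsProbabilityMeasure P]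
    (hm : m ≤ m0) {g : E → E} (hg : Continuous g) {lmin lmax : ℝ} {wo : E}
    (hlip : ∀ x, ‖g x‖ ≤ lmax * ‖wo - x‖)
    (hmono : ∀ x, ⟪wo - x, g x⟫ ≤ - (lmin * ‖wo - x‖ ^ 2))
    {s α σ : ℝ} (hs : 0 ≤ s) (X V : Ω → E) (hX : StronglyMeasurable[m] X)
    (hX2 : Integrable (fun ω => ‖wo - X ω‖ ^ 2) P)
    (hV : Integrable V P) (hV2 : Integrable (fun ω => ‖V ω‖ ^ 2) P)
    (hmean : P[V | m] =ᵐ[P] 0)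
    (hvar : ∀ᵐ ω ∂P, (P[fun ω' => ‖V ω'‖ ^ 2 | m]) ω ≤ α * ‖wo - X ω‖ ^ 2 + σ) :
    Integrable (fun ω => ‖wo - (X ω - s • (g (X ω) + V ω))‖ ^ 2) P ∧
    ∫ ω, ‖wo - (X ω - s • (g (X ω) + V ω))‖ ^ 2 ∂P ≤
      (1 - 2 * s * lmin + s ^ 2 * (lmax ^ 2 + α)) * ∫ ω, ‖wo - X ω‖ ^ 2 ∂P + s ^ 2 * σ := by
  set G : Ω → E := fun ω => (wo - X ω) + s • g (X ω) with hGdef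
  have hGm : StronglyMeasurable[m] G :=
    (show Continuous fun x : E => (wo - x) + s • g x by fun_prop).comp_stronglyMeasurable hX
  have hGm0 : AEStronglyMeasurable G P := (hGm.mono hm).aestronglyMeasurable
  have hXm0 : AEStronglyMeasurable (fun ω => wo - X ω) P :=
    ((show Continuous fun x : E => wo - x by fun_prop).comp_stronglyMeasurable
      (hX.mono hm)).aestronglyMeasurable
  have hGle : ∀ ω, ‖G ω‖ ^ 2 ≤ (1 - 2 * s * lmin + s ^ 2 * lmax ^ 2) * ‖wo - X ω‖ ^ 2 :=
    fun ω => diffu_G s hs (hlip _) (hmono _)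
  have hG2 : Integrable (fun ω => ‖G ω‖ ^ 2) P := by
    refine (hX2.const_mul (1 - 2 * s * lmin + s ^ 2 * lmax ^ 2)).mono' (hGm0.norm.pow 2) ?_
    filter_upwards with ω
    rw [Real.norm_of_nonneg (by positivity)]
    exact hGle ω
  have hGV : Integrable (fun ω => ⟪G ω, V ω⟫) P := by
    refine (hG2.add hV2).mono' (hGm0.inner hV.aestronglyMeasurable) ?_
    filter_upwards with ω
    have h1 := norm_inner_le_norm (𝕜 := ℝ) (G ω) (V ω)
    simp only [Pi.add_apply]
    nlinarith [sq_nonneg (‖G ω‖ - ‖V ω‖), sq_nonneg (‖G ω‖), sq_nonneg (‖V ω‖)]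
  have hcross : ∫ ω, ⟪G ω, V ω⟫ ∂P = 0 := by
    have h := condExp_bilin_of_stronglyMeasurable_left (μ := P) (innerSL ℝ) hGm hGV hV
    rw [← integral_condExp hm]
    refine integral_eq_zero_of_ae ?_
    refine EventuallyEq.trans h ?_
    filter_upwards [hmean] with ω hω
    simp [hω]
  have hVle : ∫ ω, ‖V ω‖ ^ 2 ∂P ≤ α * ∫ ω, ‖wo - X ω‖ ^ 2 ∂P + σ := by
    rw [← integral_condExp hm]
    refine (integral_mono_ae integrable_condExp
      ((hX2.const_mul α).add (integrable_const σ)) hvar).trans_eq ?_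
    simp only [Pi.add_apply]
    rw [integral_add (hX2.const_mul α) (integrable_const σ), integral_const_mul]
    simp
  have heq : (fun ω => ‖wo - (X ω - s • (g (X ω) + V ω))‖ ^ 2)
      = fun ω => ‖G ω‖ ^ 2 + (2 * s) * ⟪G ω, V ω⟫ + s ^ 2 * ‖V ω‖ ^ 2 := by
    funext ω
    have e : wo - (X ω - s • (g (X ω) + V ω)) = G ω + s • V ω := by
      simp only [hGdef, smul_add]; abel
    rw [e, norm_add_sq_real, norm_smul, real_inner_smul_right, Real.norm_of_nonneg hs]
    ring
  have hI1 := hGV.const_mul (2 * s)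
  have hI2 := hV2.const_mul (s ^ 2)
  rw [heq]
  refine ⟨(hG2.add hI1).add hI2, ?_⟩
  rw [integral_add (f := fun ω => ‖G ω‖ ^ 2 + (2 * s) * ⟪G ω, V ω⟫) (hG2.add hI1) hI2,
    integral_add hG2 hI1, integral_const_mul, integral_const_mul,
    hcross]
  have h1 : ∫ ω, ‖G ω‖ ^ 2 ∂P ≤
      (1 - 2 * s * lmin + s ^ 2 * lmax ^ 2) * ∫ ω, ‖wo - X ω‖ ^ 2 ∂P := by
    rw [← integral_const_mul]
    exact integral_mono hG2 (hX2.const_mul _) hGle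
  have h2 := mul_le_mul_of_nonneg_left hVle (sq_nonneg s)
  linarith

lemma diffu_jensen {N : ℕ} (a : Fin N → ℝ) (ha : ∀ l, 0 ≤ a l) (h1 : ∑ l, a l = 1)
    (wo : E) (y : Fin N → E) :
    ‖wo - ∑ l, a l • y l‖ ^ 2 ≤ ∑ l, a l * ‖wo - y l‖ ^ 2 := by
  have hc : ConvexOn ℝ Set.univ (fun x : E => ‖x‖ ^ 2) :=
    (convexOn_univ_norm).pow (fun _ _ => norm_nonneg _) 2
  have h := hc.map_sum_le (t := Finset.univ) (w := a) (p := fun l => wo - y l)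
    (fun l _ => ha l) h1 (fun _ _ => Set.mem_univ _)
  have e : wo - ∑ l, a l • y l = ∑ l, a l • (wo - y l) := by
    simp only [smul_sub, Finset.sum_sub_distrib, ← Finset.sum_smul, h1, one_smul]
  rw [e]
  simpa using h

lemma diffu_real (μs b : ℕ → ℝ) (lam c s : ℝ) (hlam : 0 < lam) (hb : ∀ n, 0 ≤ b n)
    (hc : 0 ≤ c) (hs : 0 ≤ s)
    (hμpos : ∀ i, 1 ≤ i → 0 < μs i)
    (hμsum : Tendsto (fun n => ∑ i ∈ Finset.Icc 1 n, μs i) atTop atTop)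
    (hμ0 : Tendsto μs atTop (𝓝 0))
    (hrec : ∀ n, b (n + 1) ≤ (1 - 2 * μs (n + 1) * lam + μs (n + 1) ^ 2 * c) * b n
      + μs (n + 1) ^ 2 * s) : Tendsto b atTop (𝓝 0) := by
  rw [Metric.tendsto_atTop]
  intro ε0 hε0
  obtain ⟨ε, hε, hεε⟩ : ∃ ε, 0 < ε ∧ 2 * ε = ε0 := ⟨ε0 / 2, by linarith, by ring⟩
  have ht : ∀ᶠ n in atTop, μs n < min (min (lam / (c + 1)) (lam * ε / (s + 1))) (1 / lam) :=
    hμ0.eventually_lt_const (by positivity)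
  obtain ⟨n0, hn0⟩ := eventually_atTop.1 ht
  set T : ℕ → ℝ := fun n => ∑ i ∈ Finset.Icc 1 n, μs i with hT
  have hTs : ∀ n, T (n + 1) = T n + μs (n + 1) := fun n => by
    simp only [hT]; rw [Finset.sum_Icc_succ_top (by omega)]
  set K := |b n0 - ε| with hK
  have hK0 : 0 ≤ K := abs_nonneg _
  have claim : ∀ n, n0 ≤ n → b n - ε ≤ K * Real.exp (-(lam * (T n - T n0))) := by
    intro n hn
    induction n, hn using Nat.le_induction with
    | base => simp [hK, le_abs_self]
    | succ n hn ih =>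
      have hp := hμpos (n + 1) (by omega)
      have hlt := hn0 (n + 1) (by omega)
      rw [lt_min_iff, lt_min_iff, lt_div_iff₀ (by positivity), lt_div_iff₀ (by positivity),
        lt_div_iff₀ (by positivity)] at hlt
      obtain ⟨⟨ha, hb'⟩, hc'⟩ := hlt
      set r := μs (n + 1) with hr
      have h1 : r ^ 2 * c ≤ r * lam := by nlinarith
      have h2 : r ^ 2 * s ≤ r * (lam * ε) := by nlinarith
      have h3 := mul_le_mul_of_nonneg_right h1 (hb n)
      have h4 : b (n + 1) - ε ≤ (1 - r * lam) * (b n - ε) := by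
        have := hrec n
        nlinarith
      have h5 : (1 - r * lam) * (b n - ε) ≤
          (1 - r * lam) * (K * Real.exp (-(lam * (T n - T n0)))) :=
        mul_le_mul_of_nonneg_left ih (by linarith)
      have h6 : 1 - r * lam ≤ Real.exp (-(r * lam)) := by
        have := Real.add_one_le_exp (-(r * lam)); linarith
      have h7 : (1 - r * lam) * (K * Real.exp (-(lam * (T n - T n0)))) ≤
          Real.exp (-(r * lam)) * (K * Real.exp (-(lam * (T n - T n0)))) :=
        mul_le_mul_of_nonneg_right h6 (by positivity)
      have e : -(lam * (T (n + 1) - T n0)) = -(r * lam) + -(lam * (T n - T n0)) := by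
        rw [hTs]; ring
      rw [e, Real.exp_add]
      linarith
  have hlim : Tendsto (fun n => K * Real.exp (-(lam * (T n - T n0)))) atTop (𝓝 0) := by
    have h1 : Tendsto (fun n => lam * (T n - T n0)) atTop atTop :=
      (tendsto_atTop_add_const_right _ (-T n0) hμsum).const_mul_atTop hlam
    have := (Real.tendsto_exp_neg_atTop_nhds_zero.comp h1).const_mul K
    simpa using this
  obtain ⟨n1, hn1⟩ := eventually_atTop.1 (hlim.eventually_lt_const hε)
  refine ⟨max n0 n1, fun n hn => ?_⟩
  have h1 := claim n (le_trans (le_max_left _ _) hn)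
  have h2 := hn1 n (le_trans (le_max_right _ _) hn)
  rw [Real.dist_eq, sub_zero, abs_of_nonneg (hb n)]
  linarith

end Helpers

/-- **Mean-square convergence of the diffusion strategy** (Theorem 1, part 1).
Under the diffusion learning model, if the step-size sequence is positive, non-summable
and tends to zero, then the mean-square error at every node converges to zero. -/
theorem diffusion_mean_square_convergence
    {Ω : Type*} [m0 : MeasurableSpace Ω] (P : Measure Ω) [IsProbabilityMeasure P]
    (ℱ : Filtration ℕ m0)
    {M N : ℕ}
    (J : EuclideanSpace ℝ (Fin M) → ℝ)
    (lmin lmax : ℝ) (hlmin : 0 < lmin) (hlle : lmin ≤ lmax)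
    (hJ : ContDiff ℝ 2 J)
    (hHess : ∀ x v : EuclideanSpace ℝ (Fin M),
      lmin * ‖v‖ ^ 2 ≤ ⟪v, fderiv ℝ (gradient J) x v⟫ ∧
      ⟪v, fderiv ℝ (gradient J) x v⟫ ≤ lmax * ‖v‖ ^ 2)
    (wo : EuclideanSpace ℝ (Fin M)) (hwo : gradient J wo = 0)
    (A : Matrix (Fin N) (Fin N) ℝ)
    (hA0 : ∀ l k, 0 ≤ A l k) (hA1 : ∀ k, ∑ l, A l k = 1)
    (hAprim : ∃ m : ℕ, 1 ≤ m ∧ ∀ l k, 0 < (A ^ m) l k)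
    (μs : ℕ → ℝ)
    (hμpos : ∀ i, 1 ≤ i → 0 < μs i)
    (hμsum : Tendsto (fun n => ∑ i ∈ Finset.Icc 1 n, μs i) atTop atTop)
    (hμ0 : Tendsto μs atTop (𝓝 0))
    (α σv2 : ℝ) (hα : 0 ≤ α) (hσ : 0 < σv2)
    (w ψ v : ℕ → Fin N → Ω → EuclideanSpace ℝ (Fin M))
    (hadapt : ∀ k, Adapted ℱ fun i => w i k)
    (hw0 : ∀ k, Integrable (fun ω => ‖w 0 k ω‖ ^ 2) P)
    (hupd1 : ∀ i k ω, 1 ≤ i →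
      ψ i k ω = w (i - 1) k ω - μs i • (gradient J (w (i - 1) k ω) + v i k ω))
    (hupd2 : ∀ i k ω, 1 ≤ i → w i k ω = ∑ l, A l k • ψ i l ω)
    (hvint : ∀ i k, 1 ≤ i → Integrable (v i k) P ∧ Integrable (fun ω => ‖v i k ω‖ ^ 2) P)
    (hvmean : ∀ i k, 1 ≤ i → P[v i k | ℱ (i - 1)] =ᵐ[P] 0)
    (hvvar : ∀ i k, 1 ≤ i → ∀ᵐ ω ∂P,
      (P[fun ω' => ‖v i k ω'‖ ^ 2 | ℱ (i - 1)]) ω ≤ α * ‖wo - w (i - 1) k ω‖ ^ 2 + σv2) :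
    ∀ k, Tendsto (fun i => ∫ ω, ‖wo - w i k ω‖ ^ 2 ∂P) atTop (𝓝 0) := by
  have hg : Continuous (gradient J) := (diffu_contDiff_gradient hJ).continuous
  have hlip := fun x => diffu_lip hJ hlmin hlle hHess wo x hwo
  have hmono := fun x => diffu_mono hJ hHess wo x hwo
  have hwm : ∀ i k, StronglyMeasurable[ℱ i] (w i k) := fun i k =>
    (hadapt k i).stronglyMeasurable
  have hwm0 : ∀ i k, AEStronglyMeasurable (fun ω => ‖wo - w i k ω‖ ^ 2) P := fun i k =>
    ((show Continuous fun x : EuclideanSpace ℝ (Fin M) => ‖wo - x‖ ^ 2 by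
      fun_prop).comp_stronglyMeasurable ((hwm i k).mono (ℱ.le i))).aestronglyMeasurable
  have hint0 : ∀ k, Integrable (fun ω => ‖wo - w 0 k ω‖ ^ 2) P := by
    intro k
    refine (((integrable_const (‖wo‖ ^ 2)).add (hw0 k)).const_mul 2).mono' (hwm0 0 k) ?_
    filter_upwards with ω
    rw [Real.norm_of_nonneg (by positivity)]
    have h1 : ‖wo - w 0 k ω‖ ^ 2 ≤ (‖wo‖ + ‖w 0 k ω‖) ^ 2 := by
      gcongr; exact norm_sub_le _ _
    simp only [Pi.add_apply]
    nlinarith [sq_nonneg (‖wo‖ - ‖w 0 k ω‖)]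
  set q : ℕ → ℝ := fun i => 1 - 2 * μs i * lmin + μs i ^ 2 * (lmax ^ 2 + α) with hq
  have hq0 : ∀ i, 0 ≤ q i := by
    intro i
    have h1 : lmin ^ 2 ≤ lmax ^ 2 := by gcongr
    have h2 := mul_le_mul_of_nonneg_left h1 (sq_nonneg (μs i))
    have h3 := mul_nonneg (sq_nonneg (μs i)) hα
    simp only [hq]
    nlinarith [sq_nonneg (1 - μs i * lmin)]
  let b : ℕ → ℝ := fun n => Nat.rec (∑ k, ∫ ω, ‖wo - w 0 k ω‖ ^ 2 ∂P)
    (fun n r => q (n + 1) * r + μs (n + 1) ^ 2 * σv2) n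
  have hb0 : b 0 = ∑ k, ∫ ω, ‖wo - w 0 k ω‖ ^ 2 ∂P := rfl
  have hbs : ∀ n, b (n + 1) = q (n + 1) * b n + μs (n + 1) ^ 2 * σv2 := fun n => rfl
  have hbnn : ∀ n, 0 ≤ b n := by
    intro n
    induction n with
    | zero => rw [hb0]; exact Finset.sum_nonneg fun k _ => integral_nonneg fun ω => by positivity
    | succ n ih =>
      rw [hbs]
      exact add_nonneg (mul_nonneg (hq0 _) ih) (by positivity)
  have main : ∀ n k, Integrable (fun ω => ‖wo - w n k ω‖ ^ 2) P ∧
      ∫ ω, ‖wo - w n k ω‖ ^ 2 ∂P ≤ b n := by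
    intro n
    induction n with
    | zero =>
      intro k
      refine ⟨hint0 k, ?_⟩
      rw [hb0]
      exact Finset.single_le_sum (f := fun k => ∫ ω, ‖wo - w 0 k ω‖ ^ 2 ∂P)
        (fun k _ => integral_nonneg fun ω => by positivity) (Finset.mem_univ k)
    | succ n ih =>
      have hψ : ∀ l, Integrable (fun ω => ‖wo - ψ (n + 1) l ω‖ ^ 2) P ∧
          ∫ ω, ‖wo - ψ (n + 1) l ω‖ ^ 2 ∂P ≤ b (n + 1) := by
        intro l
        have h := diffu_step P (ℱ.le n) hg hlip hmono (hμpos (n + 1) (by omega)).le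
          (w n l) (v (n + 1) l) (hwm n l) (ih l).1 (hvint (n + 1) l (by omega)).1
          (hvint (n + 1) l (by omega)).2 (hvmean (n + 1) l (by omega))
          (hvvar (n + 1) l (by omega))
        have e : (fun ω => ‖wo - ψ (n + 1) l ω‖ ^ 2) = fun ω =>
            ‖wo - (w n l ω - μs (n + 1) • (gradient J (w n l ω) + v (n + 1) l ω))‖ ^ 2 := by
          funext ω
          rw [hupd1 (n + 1) l ω (by omega)]
          rfl
        rw [e]
        refine ⟨h.1, h.2.trans ?_⟩
        rw [hbs]
        have := mul_le_mul_of_nonneg_left (ih l).2 (hq0 (n + 1))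
        simp only [hq] at this ⊢
        linarith
      intro k
      have hle : ∀ ω, ‖wo - w (n + 1) k ω‖ ^ 2 ≤ ∑ l, A l k * ‖wo - ψ (n + 1) l ω‖ ^ 2 := by
        intro ω
        rw [hupd2 (n + 1) k ω (by omega)]
        exact diffu_jensen _ (fun l => hA0 l k) (hA1 k) wo _
      have hI : Integrable (fun ω => ∑ l, A l k * ‖wo - ψ (n + 1) l ω‖ ^ 2) P :=
        integrable_finsetSum _ fun l _ => (hψ l).1.const_mul _
      have hI1 : Integrable (fun ω => ‖wo - w (n + 1) k ω‖ ^ 2) P := by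
        refine hI.mono' (hwm0 (n + 1) k) ?_
        filter_upwards with ω
        rw [Real.norm_of_nonneg (by positivity)]
        exact hle ω
      refine ⟨hI1, (integral_mono hI1 hI hle).trans ?_⟩
      rw [integral_finsetSum _ fun l _ => (hψ l).1.const_mul _]
      calc ∑ l, ∫ ω, A l k * ‖wo - ψ (n + 1) l ω‖ ^ 2 ∂P
          ≤ ∑ l, A l k * b (n + 1) := by
            refine Finset.sum_le_sum fun l _ => ?_
            rw [integral_const_mul]
            exact mul_le_mul_of_nonneg_left (hψ l).2 (hA0 l k)
        _ = b (n + 1) := by rw [← Finset.sum_mul, hA1, one_mul]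
  have hbt : Tendsto b atTop (𝓝 0) :=
    diffu_real μs b lmin (lmax ^ 2 + α) σv2 hlmin hbnn (by positivity) hσ.le hμpos hμsum hμ0
      fun n => (hbs n).le
  intro k
  exact squeeze_zero (fun n => integral_nonneg fun ω => by positivity) (fun n => (main n k).2) hbt
end

section
/- Almost-sure convergence of the diffusion strategy (Theorem 1, part 2): Assume the diffusion learning model, and assume the step-size sequence satisfies μ(i) > 0 for all i, ∑_{i=1}^∞ μ(i) = ∞, μ(i) → 0 as i → ∞, and additionally ∑_{i=1}^∞ μ(i)² < ∞. Then for every node k ∈ {1,…,N}, w_{k,i} → w° almost surely as i → ∞. -/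
open MeasureTheory Filter Topology RealInnerProductSpace

lemma ds_perron {N : ℕ} (k0 : Fin N) (A : Matrix (Fin N) (Fin N) ℝ)
    (hA0 : ∀ l k, 0 ≤ A l k) (hA1 : ∀ k, ∑ l, A l k = 1)
    (hAprim : ∃ m : ℕ, 1 ≤ m ∧ ∀ l k, 0 < (A ^ m) l k) :
    ∃ p : Fin N → ℝ, (∀ k, 0 < p k) ∧ ∀ l, ∑ k, A l k * p k = p l := by
  have h1 : ∃ y : Fin N → ℝ, y ≠ 0 ∧ Matrix.vecMul y (A - 1) = 0 := by
    refine ⟨fun _ => 1, fun h => by simpa using congrFun h k0, ?_⟩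
    ext k
    simp [Matrix.vecMul, dotProduct, Finset.sum_sub_distrib, hA1, Matrix.one_apply]
  have hdet : (A - 1).det = 0 := Matrix.exists_vecMul_eq_zero_iff.mp h1
  obtain ⟨x, hx0, hx⟩ := Matrix.exists_mulVec_eq_zero_iff.mpr hdet
  have hAx : ∀ l, ∑ k, A l k * x k = x l := by
    intro l
    have := congrFun hx l
    rw [Matrix.sub_mulVec, Matrix.one_mulVec] at this
    simp [Matrix.mulVec, dotProduct] at this
    linarith
  have hle : ∀ l ∈ Finset.univ, |x l| ≤ ∑ k, A l k * |x k| := by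
    intro l _
    rw [← hAx l]
    refine (Finset.abs_sum_le_sum_abs _ _).trans (le_of_eq ?_)
    refine Finset.sum_congr rfl fun k _ => ?_
    rw [abs_mul, abs_of_nonneg (hA0 l k)]
  have hsum : ∑ l, |x l| = ∑ l, ∑ k, A l k * |x k| := by
    rw [Finset.sum_comm]
    refine Finset.sum_congr rfl fun k _ => ?_
    rw [← Finset.sum_mul, hA1, one_mul]
  have heq := (Finset.sum_eq_sum_iff_of_le hle).mp hsum
  have hmv : A.mulVec (fun k => |x k|) = fun k => |x k| := by
    ext l
    exact (heq l (Finset.mem_univ l)).symm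
  have hpow : ∀ n : ℕ, (A ^ n).mulVec (fun k => |x k|) = fun k => |x k| := by
    intro n
    induction n with
    | zero => simp
    | succ n ih => rw [pow_succ, ← Matrix.mulVec_mulVec, hmv, ih]
  refine ⟨fun k => |x k|, fun k => ?_, fun l => (heq l (Finset.mem_univ l)).symm⟩
  obtain ⟨m, _, hm⟩ := hAprim
  obtain ⟨j, hj⟩ := Function.ne_iff.mp hx0
  have := congrFun (hpow m) k
  change 0 < |x k|
  rw [← this]
  refine Finset.sum_pos' (fun i _ => mul_nonneg (hm k i).le (abs_nonneg _)) ⟨j, Finset.mem_univ j, ?_⟩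
  exact mul_pos (hm k j) (abs_pos.mpr hj)

lemma ds_grad {M : ℕ} (J : EuclideanSpace ℝ (Fin M) → ℝ)
    (lmin lmax : ℝ) (hlmin : 0 < lmin) (hlle : lmin ≤ lmax)
    (hJ : ContDiff ℝ 2 J)
    (hHess : ∀ x v : EuclideanSpace ℝ (Fin M),
      lmin * ‖v‖ ^ 2 ≤ ⟪v, fderiv ℝ (gradient J) x v⟫ ∧
      ⟪v, fderiv ℝ (gradient J) x v⟫ ≤ lmax * ‖v‖ ^ 2) 
    (wo : EuclideanSpace ℝ (Fin M)) (hwo : gradient J wo = 0) :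
    Continuous (gradient J) ∧ ∀ x, ‖gradient J x‖ ≤ lmax * ‖x - wo‖ ∧
      lmin * ‖x - wo‖ ^ 2 ≤ ⟪x - wo, gradient J x⟫ := by
  have hlmax : 0 < lmax := hlmin.trans_le hlle
  have hJ1 : ContDiff ℝ 1 (fderiv ℝ J) := hJ.fderiv_right (by norm_num)
  have hG : ContDiff ℝ 1 (gradient J) := by
    change ContDiff ℝ 1 (fun x => (InnerProductSpace.toDual ℝ _).symm (fderiv ℝ J x))
    exact (InnerProductSpace.toDual ℝ (EuclideanSpace ℝ (Fin M))).symm.contDiff.comp hJ1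
  have hdG : Differentiable ℝ (gradient J) := hG.differentiable (by norm_num)
  have hinner : ∀ x a b, ⟪a, fderiv ℝ (gradient J) x b⟫ = fderiv ℝ (fderiv ℝ J) x b a := by
    intro x a b
    have h : HasFDerivAt (gradient J) (((InnerProductSpace.toDual ℝ (EuclideanSpace ℝ (Fin M))).symm.toContinuousLinearEquiv.toContinuousLinearMap).comp (fderiv ℝ (fderiv ℝ J) x)) x := by
      exact (InnerProductSpace.toDual ℝ (EuclideanSpace ℝ (Fin M))).symm.toContinuousLinearEquiv.toContinuousLinearMap.hasFDerivAt.comp x ((hJ1.differentiable (by norm_num)) x).hasFDerivAt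
    rw [h.fderiv, real_inner_comm]
    simp
  have hsymm : ∀ x a b, ⟪a, fderiv ℝ (gradient J) x b⟫ = ⟪b, fderiv ℝ (gradient J) x a⟫ := by
    intro x a b
    rw [hinner, hinner]
    exact (hJ.contDiffAt.isSymmSndFDerivAt (by simp)) b a
  have hnorm : ∀ x, ‖fderiv ℝ (gradient J) x‖ ≤ lmax := by
    intro x
    refine ContinuousLinearMap.opNorm_le_bound _ hlmax.le fun y => ?_
    set H := fderiv ℝ (gradient J) x with hH
    have h1 := (hHess x (H y + lmax • y)).2
    have h2 := (hHess x (H y - lmax • y)).1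
    have h3 : 0 ≤ lmin * ‖H y - lmax • y‖ ^ 2 := by positivity
    rw [← hH] at h1 h2
    have h4 := hsymm x (H y) y
    rw [← hH] at h4
    simp only [map_add, map_sub, map_smul, inner_add_left, inner_add_right, inner_sub_left, inner_sub_right,
      real_inner_smul_left, real_inner_smul_right] at h1 h2
    have h5 := parallelogram_law_with_norm ℝ (H y) (lmax • y)
    have h6 : 0 ≤ ‖H y - lmax • y‖ ^ 2 := by positivity
    rw [norm_smul, Real.norm_of_nonneg hlmax.le] at h5
    rw [← h4, real_inner_self_eq_norm_sq] at h1 h2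
    have h7 : 4 * lmax * ‖H y‖ ^ 2 ≤ lmax * (2 * (‖H y‖ ^ 2 + (lmax * ‖y‖) ^ 2)) := by
      nlinarith
    have h8 : ‖H y‖ ^ 2 ≤ (lmax * ‖y‖) ^ 2 := by
      by_contra hc
      push Not at hc
      nlinarith
    exact le_of_sq_le_sq h8 (by positivity)
  refine ⟨hG.continuous, fun x => ⟨?_, ?_⟩⟩
  · have := convex_univ.norm_image_sub_le_of_norm_fderiv_le (𝕜 := ℝ) (f := gradient J) (C := lmax)
      (fun x _ => hdG x) (fun x _ => hnorm x) (Set.mem_univ wo) (Set.mem_univ x)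
    rwa [hwo, sub_zero] at this
  · set d := x - wo with hd
    let g : ℝ → ℝ := fun t => ⟪d, gradient J (wo + t • d)⟫
    have hg : ∀ t, HasDerivAt g (⟪d, fderiv ℝ (gradient J) (wo + t • d) d⟫) t := by
      intro t
      have h1 : HasDerivAt (fun t : ℝ => wo + t • d) d t := by
        simpa using ((hasDerivAt_id t).smul_const d).const_add wo
      have h2 := (hdG (wo + t • d)).hasFDerivAt.comp_hasDerivAt t h1
      have h3 := (hasDerivAt_const t d).inner ℝ h2
      rw [inner_zero_left, add_zero] at h3
      exact h3
    obtain ⟨c, _, hc⟩ := exists_hasDerivAt_eq_slope g _ (zero_lt_one)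
      (fun t _ => (hg t).continuousAt.continuousWithinAt) (fun t _ => hg t)
    have := (hHess (wo + c • d) d).1
    rw [hc] at this
    have g0 : g 0 = 0 := by
      change ⟪d, gradient J (wo + (0:ℝ) • d)⟫ = 0
      rw [zero_smul, add_zero, hwo, inner_zero_right]
    have g1 : g 1 = ⟪d, gradient J x⟫ := by
      change ⟪d, gradient J (wo + (1:ℝ) • d)⟫ = _
      rw [one_smul, hd, add_sub_cancel]
    rw [g0, g1] at this
    simpa only [sub_zero, div_one] using this

lemma ds_det (e b c : ℕ → ℝ) (hb : ∀ i, 0 ≤ b i) (hc : ∀ i, 0 ≤ c i) (he : ∀ i, 0 ≤ e i)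
    (hbs : Summable b) (hcs : Summable c) (h : ∀ i, e (i+1) ≤ (1 + b i) * e i + c i) :
    ∃ K, 0 ≤ K ∧ ∀ i, e i ≤ K := by
  have key : ∀ n, e n ≤ Real.exp (∑ i ∈ Finset.range n, b i) * (e 0 + ∑ i ∈ Finset.range n, c i) := by
    intro n
    induction n with
    | zero => simp
    | succ n ih =>
      rw [Finset.sum_range_succ, Finset.sum_range_succ, Real.exp_add]
      set E := Real.exp (∑ i ∈ Finset.range n, b i) with hE
      set S := e 0 + ∑ i ∈ Finset.range n, c i with hS
      have h1 : 1 ≤ E := Real.one_le_exp (Finset.sum_nonneg fun i _ => hb i)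
      have h2 : 1 + b n ≤ Real.exp (b n) := by linarith [Real.add_one_le_exp (b n)]
      have hS0 : 0 ≤ S := add_nonneg (he 0) (Finset.sum_nonneg fun i _ => hc i)
      have h3 : (1 + b n) * e n ≤ Real.exp (b n) * (E * S) :=
        mul_le_mul h2 ih (he n) (Real.exp_pos _).le
      have h4 : 1 ≤ E * Real.exp (b n) := one_le_mul_of_one_le_of_one_le h1 (by linarith [hb n])
      have h5 : c n ≤ E * Real.exp (b n) * c n := le_mul_of_one_le_left (hc n) h4
      calc _ ≤ _ := h n
        _ ≤ Real.exp (b n) * (E * S) + E * Real.exp (b n) * c n := add_le_add h3 h5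
        _ = _ := by rw [← add_assoc, ← hS]; ring
  refine ⟨Real.exp (∑' i, b i) * (e 0 + ∑' i, c i), ?_, fun n => (key n).trans ?_⟩
  · exact mul_nonneg (Real.exp_pos _).le (add_nonneg (he 0) (tsum_nonneg hc))
  · have h1 := hbs.sum_le_tsum (Finset.range n) (fun i _ => hb i)
    have h2 := hcs.sum_le_tsum (Finset.range n) (fun i _ => hc i)
    have h3 : 0 ≤ e 0 + ∑ i ∈ Finset.range n, c i := add_nonneg (he 0) (Finset.sum_nonneg fun i _ => hc i)
    gcongr

lemma ds_ae_summable {Ω : Type*} [MeasurableSpace Ω] (P : Measure Ω) (f : ℕ → Ω → ℝ)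
    (hf0 : ∀ i ω, 0 ≤ f i ω) (hfi : ∀ i, Integrable (f i) P)
    (hs : Summable fun i => ∫ ω, f i ω ∂P) : ∀ᵐ ω ∂P, Summable fun i => f i ω := by
  have h1 : ∫⁻ ω, ∑' i, ENNReal.ofReal (f i ω) ∂P ≠ ⊤ := by
    rw [lintegral_tsum (fun i => (hfi i).aemeasurable.ennreal_ofReal)]
    simp_rw [← fun i => ofReal_integral_eq_lintegral_ofReal (hfi i) (ae_of_all _ (hf0 i))]
    exact hs.tsum_ofReal_ne_top
  have h2 := ae_lt_top' (AEMeasurable.tsum fun i => (hfi i).aemeasurable.ennreal_ofReal) h1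
  filter_upwards [h2] with ω hω
  have := ENNReal.summable_toReal hω.ne
  simpa [ENNReal.toReal_ofReal, hf0] using this

lemma ds_rs {Ω : Type*} [m0 : MeasurableSpace Ω] (P : Measure Ω) [IsProbabilityMeasure P]
    (ℱ : Filtration ℕ m0) (V : ℕ → Ω → ℝ) (b c d : ℕ → ℝ)
    (hV0 : ∀ i ω, 0 ≤ V i ω) (hVi : ∀ i, Integrable (V i) P) (hVa : StronglyAdapted ℱ V)
    (hb : ∀ i, 0 ≤ b i) (hc : ∀ i, 0 ≤ c i) (hd : ∀ i, 0 ≤ d i)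
    (hbs : Summable b) (hcs : Summable c) (hds : ¬ Summable d)
    (h : ∀ i, P[V (i+1) | ℱ i] ≤ᵐ[P] fun ω => (1 + b i - d i) * V i ω + c i) :
    ∀ᵐ ω ∂P, Tendsto (fun i => V i ω) atTop (𝓝 0) := by
  set e : ℕ → ℝ := fun i => ∫ ω, V i ω ∂P with he
  have he0 : ∀ i, 0 ≤ e i := fun i => integral_nonneg (hV0 i)
  have hrec : ∀ i, e (i+1) ≤ (1 + b i - d i) * e i + c i := by
    intro i
    have h1 : e (i+1) = ∫ ω, (P[V (i+1) | ℱ i]) ω ∂P := (integral_condExp (ℱ.le i)).symm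
    rw [h1]
    refine (integral_mono_ae integrable_condExp (((hVi i).const_mul _).add (integrable_const _)) (h i)).trans ?_
    simp only [Pi.add_apply]
    rw [integral_add ((hVi i).const_mul _) (integrable_const _), integral_const_mul]
    simp [he]
  obtain ⟨K, hK0, hK⟩ := ds_det e b c hb hc he0 hbs hcs (fun i => by
    have := hrec i; nlinarith [mul_nonneg (hd i) (he0 i)])
  have hbe : Summable fun i => b i * e i :=
    Summable.of_nonneg_of_le (fun i => mul_nonneg (hb i) (he0 i))
      (fun i => mul_le_mul_of_nonneg_left (hK i) (hb i)) (hbs.mul_right K)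
  have hde : Summable fun i => d i * e i := by
    refine summable_of_sum_range_le (c := e 0 + ∑' i, (b i * e i + c i))
      (fun i => mul_nonneg (hd i) (he0 i)) fun n => ?_
    have h1 : ∑ i ∈ Finset.range n, d i * e i + e n ≤ e 0 + ∑ i ∈ Finset.range n, (b i * e i + c i) := by
      induction n with
      | zero => simp
      | succ n ih =>
        rw [Finset.sum_range_succ, Finset.sum_range_succ]
        linarith [hrec n]
    have h2 := (hbe.add hcs).sum_le_tsum (Finset.range n) (fun i _ => add_nonneg (mul_nonneg (hb i) (he0 i)) (hc i))
    linarith [he0 n]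
  have hbV := ds_ae_summable P (fun i ω => b i * V i ω) (fun i ω => mul_nonneg (hb i) (hV0 i ω))
    (fun i => (hVi i).const_mul _) (by simpa [integral_const_mul] using hbe)
  have hdV := ds_ae_summable P (fun i ω => d i * V i ω) (fun i ω => mul_nonneg (hd i) (hV0 i ω))
    (fun i => (hVi i).const_mul _) (by simpa [integral_const_mul] using hde)
  let Y : ℕ → Ω → ℝ := fun n ω => V n ω - ∑ i ∈ Finset.range n, (b i * V i ω + c i)
  have hSi : ∀ n, Integrable (fun ω => ∑ i ∈ Finset.range n, (b i * V i ω + c i)) P := fun n =>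
    integrable_finsetSum _ fun i _ => ((hVi i).const_mul _).add (integrable_const _)
  have hSm : ∀ n m, n ≤ m + 1 → StronglyMeasurable[ℱ m] (fun ω => ∑ i ∈ Finset.range n, (b i * V i ω + c i)) := by
    intro n m hnm
    refine Finset.stronglyMeasurable_fun_sum _ fun i hi => ?_
    have hi' : i ≤ m := by have := Finset.mem_range.mp hi; omega
    exact (((hVa i).mono (ℱ.mono hi')).const_mul _).add stronglyMeasurable_const
  have hYi : ∀ n, Integrable (Y n) P := fun n => (hVi n).sub (hSi n)
  have hY : Supermartingale Y ℱ P := by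
    refine supermartingale_nat (fun n => (hVa n).sub (hSm n n (Nat.le_succ n))) hYi fun n => ?_
    have h1 := condExp_sub (μ := P) (hVi (n+1)) (hSi (n+1)) (ℱ n)
    rw [condExp_of_stronglyMeasurable (ℱ.le n) (hSm (n+1) n le_rfl) (hSi (n+1))] at h1
    have h1' : P[Y (n+1) | ℱ n] =ᵐ[P] P[V (n+1) | ℱ n] - fun ω => ∑ i ∈ Finset.range (n+1), (b i * V i ω + c i) := h1
    filter_upwards [h1', h n] with ω hω1 hω2
    rw [hω1]
    simp only [Pi.sub_apply, Y, Finset.sum_range_succ]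
    nlinarith [mul_nonneg (hd n) (hV0 n ω)]
  have hbd : ∀ n, eLpNorm ((-Y) n) 1 P ≤ ((K + ∑' i, (b i * e i + c i)).toNNReal : ENNReal) := by
    intro n
    rw [Pi.neg_apply, eLpNorm_neg, eLpNorm_one_eq_lintegral_enorm, ← ofReal_integral_norm_eq_lintegral_enorm (hYi n)]
    refine ENNReal.ofReal_le_ofReal ?_
    have h1 : ∫ ω, ‖Y n ω‖ ∂P ≤ ∫ ω, (V n ω + ∑ i ∈ Finset.range n, (b i * V i ω + c i)) ∂P := by
      refine integral_mono (hYi n).norm ((hVi n).add (hSi n)) fun ω => ?_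
      refine (norm_sub_le _ _).trans ?_
      rw [Real.norm_of_nonneg (hV0 n ω), Real.norm_of_nonneg]
      exact Finset.sum_nonneg fun i _ => add_nonneg (mul_nonneg (hb i) (hV0 i ω)) (hc i)
    refine h1.trans ?_
    rw [integral_add (hVi n) (hSi n), integral_finsetSum (f := fun i ω => b i * V i ω + c i) _ fun i _ => ((hVi i).const_mul _).add (integrable_const _)]
    refine add_le_add (hK n) ?_
    have h2 := (hbe.add hcs).sum_le_tsum (Finset.range n) (fun i _ => add_nonneg (mul_nonneg (hb i) (he0 i)) (hc i))
    refine le_trans (le_of_eq (Finset.sum_congr rfl fun i _ => ?_)) h2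
    rw [integral_add ((hVi i).const_mul _) (integrable_const _), integral_const_mul]
    simp [he]
  filter_upwards [hY.neg.exists_ae_tendsto_of_bdd hbd, hbV, hdV] with ω ⟨y, hy⟩ hω1 hω2
  have hS := (hω1.add hcs).hasSum.tendsto_sum_nat
  have hVlim : ∃ x, Tendsto (fun i => V i ω) atTop (𝓝 x) := by
    refine ⟨_, (hS.sub hy).congr fun n => ?_⟩
    simp [Y]
  obtain ⟨x, hx⟩ := hVlim
  have hx0 : 0 ≤ x := ge_of_tendsto' hx fun i => hV0 i ω
  rcases hx0.eq_or_lt with h0 | h0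
  · rwa [← h0] at hx
  exfalso
  apply hds
  have hev : ∀ᶠ i in atTop, x / 2 ≤ V i ω := hx.eventually_const_le (by linarith)
  have h3 : Summable fun i => (2 / x) * (d i * V i ω) := hω2.mul_left _
  refine Summable.of_norm_bounded_eventually_nat h3 ?_
  filter_upwards [hev] with i hi
  rw [Real.norm_of_nonneg (hd i)]
  have : 1 ≤ (2 / x) * V i ω := by
    calc (1:ℝ) = (2 / x) * (x / 2) := by field_simp
      _ ≤ _ := by gcongr
  nlinarith [hd i]

lemma ds_step {Ω : Type*} [m0 : MeasurableSpace Ω] (P : Measure Ω) [IsProbabilityMeasure P]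
    (m : MeasurableSpace Ω) (hm : m ≤ m0) {M : ℕ}
    (D v : Ω → EuclideanSpace ℝ (Fin M)) (μ : ℝ) (C : Ω → ℝ)
    (hDm : StronglyMeasurable[m] D) (hD : MemLp D 2 P) (hv : MemLp v 2 P)
    (hmean : P[v | m] =ᵐ[P] 0)
    (hvar : ∀ᵐ ω ∂P, (P[fun ω' => ‖v ω'‖ ^ 2 | m]) ω ≤ C ω) :
    P[fun ω => ‖D ω - μ • v ω‖ ^ 2 | m] ≤ᵐ[P] fun ω => ‖D ω‖ ^ 2 + μ ^ 2 * C ω := by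
  have hDi : Integrable (fun ω => ‖D ω‖ ^ 2) P := hD.integrable_norm_pow (by norm_num)
  have hvi : Integrable (fun ω => ‖v ω‖ ^ 2) P := hv.integrable_norm_pow (by norm_num)
  have hin : Integrable (fun ω => ⟪D ω, v ω⟫) P := by
    refine Integrable.mono' (hDi.add hvi) (hD.1.inner hv.1) (ae_of_all _ fun ω => ?_)
    refine (norm_inner_le_norm _ _).trans ?_
    simp only [Pi.add_apply]
    nlinarith [sq_nonneg (‖D ω‖ - ‖v ω‖), sq_nonneg (‖D ω‖), sq_nonneg ‖v ω‖]
  have hpull : P[fun ω => ⟪D ω, v ω⟫ | m] =ᵐ[P] 0 := by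
    have := condExp_bilin_of_stronglyMeasurable_left (m := m) (μ := P)
      (innerSL ℝ) hDm (g := v) hin (hv.integrable (by norm_num))
    change P[fun ω => ⟪D ω, v ω⟫ | m] =ᵐ[P] fun ω => ⟪D ω, (P[v | m]) ω⟫ at this
    filter_upwards [this, hmean] with ω h1 h2
    rw [h1, h2]; simp
  have heq : (fun ω => ‖D ω - μ • v ω‖ ^ 2) =
      (fun ω => ‖D ω‖ ^ 2) + ((-2 * μ) • (fun ω => ⟪D ω, v ω⟫) + (μ ^ 2) • fun ω => ‖v ω‖ ^ 2) := by
    ext ω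
    simp only [Pi.add_apply, Pi.smul_apply, smul_eq_mul]
    rw [norm_sub_sq_real, real_inner_smul_right, norm_smul, mul_pow, Real.norm_eq_abs, sq_abs]
    ring
  rw [heq]
  have h1 := condExp_add (μ := P) hDi ((hin.smul (-2 * μ)).add (hvi.smul (μ ^ 2))) m
  have h2 := condExp_add (μ := P) (hin.smul (-2 * μ)) (hvi.smul (μ ^ 2)) m
  have h3 := condExp_smul (μ := P) (-2 * μ) (fun ω => ⟪D ω, v ω⟫) m
  have h4 := condExp_smul (μ := P) (μ ^ 2) (fun ω => ‖v ω‖ ^ 2) m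
  have hD2m : StronglyMeasurable[m] (fun ω => ‖D ω‖ ^ 2) := hDm.norm.pow 2
  rw [condExp_of_stronglyMeasurable hm hD2m hDi] at h1
  filter_upwards [h1, h2, h3, h4, hpull, hvar] with ω e1 e2 e3 e4 e5 e6
  rw [e1, Pi.add_apply, e2, Pi.add_apply, e3, e4, Pi.smul_apply, e5, Pi.smul_apply]
  simp only [Pi.zero_apply, smul_eq_mul, mul_zero, zero_add]
  gcongr

lemma ds_jensen {N M : ℕ} (a : Fin N → ℝ) (ha : ∀ l, 0 ≤ a l) (hs : ∑ l, a l = 1)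
    (x : Fin N → EuclideanSpace ℝ (Fin M)) (y : EuclideanSpace ℝ (Fin M)) :
    ‖(∑ l, a l • x l) - y‖ ^ 2 ≤ ∑ l, a l * ‖x l - y‖ ^ 2 := by
  have h1 : (∑ l, a l • x l) - y = ∑ l, a l • (x l - y) := by
    simp only [smul_sub, Finset.sum_sub_distrib]
    rw [← Finset.sum_smul, hs, one_smul]
  rw [h1]
  have hcv : ConvexOn ℝ Set.univ (fun z : EuclideanSpace ℝ (Fin M) => ‖z‖ ^ 2) :=
    convexOn_univ_norm.pow (fun _ _ => norm_nonneg _) 2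
  simpa using hcv.map_sum_le (t := Finset.univ) (w := a) (p := fun l => x l - y)
    (fun l _ => ha l) hs (fun _ _ => Set.mem_univ _)

theorem diffusion_almost_sure_convergence
    {Ω : Type*} [m0 : MeasurableSpace Ω] (P : Measure Ω) [IsProbabilityMeasure P]
    (ℱ : Filtration ℕ m0)
    {M N : ℕ}
    (J : EuclideanSpace ℝ (Fin M) → ℝ)
    (lmin lmax : ℝ) (hlmin : 0 < lmin) (hlle : lmin ≤ lmax)
    (hJ : ContDiff ℝ 2 J)
    (hHess : ∀ x v : EuclideanSpace ℝ (Fin M),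
      lmin * ‖v‖ ^ 2 ≤ ⟪v, fderiv ℝ (gradient J) x v⟫ ∧
      ⟪v, fderiv ℝ (gradient J) x v⟫ ≤ lmax * ‖v‖ ^ 2)
    (wo : EuclideanSpace ℝ (Fin M)) (hwo : gradient J wo = 0)
    (A : Matrix (Fin N) (Fin N) ℝ)
    (hA0 : ∀ l k, 0 ≤ A l k) (hA1 : ∀ k, ∑ l, A l k = 1)
    (hAprim : ∃ m : ℕ, 1 ≤ m ∧ ∀ l k, 0 < (A ^ m) l k)
    (μs : ℕ → ℝ)
    (hμpos : ∀ i, 1 ≤ i → 0 < μs i)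
    (hμsum : Tendsto (fun n => ∑ i ∈ Finset.Icc 1 n, μs i) atTop atTop)
    (hμ0 : Tendsto μs atTop (𝓝 0))
    (hμsq : Summable fun i => (μs i) ^ 2)
    (α σv2 : ℝ) (hα : 0 ≤ α) (hσ : 0 < σv2)
    (w ψ v : ℕ → Fin N → Ω → EuclideanSpace ℝ (Fin M))
    (hadapt : ∀ k, Adapted ℱ fun i => w i k)
    (hw0 : ∀ k, Integrable (fun ω => ‖w 0 k ω‖ ^ 2) P)
    (hupd1 : ∀ i k ω, 1 ≤ i →
      ψ i k ω = w (i - 1) k ω - μs i • (gradient J (w (i - 1) k ω) + v i k ω))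
    (hupd2 : ∀ i k ω, 1 ≤ i → w i k ω = ∑ l, A l k • ψ i l ω)
    (hvint : ∀ i k, 1 ≤ i → Integrable (v i k) P ∧ Integrable (fun ω => ‖v i k ω‖ ^ 2) P)
    (hvmean : ∀ i k, 1 ≤ i → P[v i k | ℱ (i - 1)] =ᵐ[P] 0)
    (hvvar : ∀ i k, 1 ≤ i → ∀ᵐ ω ∂P,
      (P[fun ω' => ‖v i k ω'‖ ^ 2 | ℱ (i - 1)]) ω ≤ α * ‖wo - w (i - 1) k ω‖ ^ 2 + σv2) :
    ∀ k, ∀ᵐ ω ∂P, Tendsto (fun i => w i k ω) atTop (𝓝 wo) := by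
  intro k0
  obtain ⟨p, hp, hAp⟩ := ds_perron k0 A hA0 hA1 hAprim
  obtain ⟨hGc, hG⟩ := ds_grad J lmin lmax hlmin hlle hJ hHess wo hwo
  have hwm : ∀ i k, StronglyMeasurable[ℱ i] (w i k) := fun i k => (hadapt k i).stronglyMeasurable
  have hv2 : ∀ i k, MemLp (v (i+1) k) 2 P := fun i k =>
    (memLp_two_iff_integrable_sq_norm (hvint (i+1) k (by omega)).1.1).mpr (hvint (i+1) k (by omega)).2
  have hg2 : ∀ i k, MemLp (w i k) 2 P → MemLp (fun ω => gradient J (w i k ω)) 2 P := by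
    intro i k h
    refine MemLp.of_le_mul (c := lmax) (h.sub (memLp_const wo))
      (hGc.comp_aestronglyMeasurable h.1) (ae_of_all _ fun ω => (hG _).1)
  have hψ : ∀ i k ω, ψ (i+1) k ω = w i k ω - μs (i+1) • (gradient J (w i k ω) + v (i+1) k ω) :=
    fun i k ω => hupd1 (i+1) k ω (by omega)
  have hψ2 : ∀ i k, MemLp (w i k) 2 P → MemLp (ψ (i+1) k) 2 P := by
    intro i k h
    have : ψ (i+1) k = fun ω => w i k ω - μs (i+1) • (gradient J (w i k ω) + v (i+1) k ω) :=
      funext (hψ i k)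
    rw [this]
    exact h.sub (((hg2 i k h).add (hv2 i k)).const_smul (μs (i+1)))
  have hw2 : ∀ i k, MemLp (w i k) 2 P := by
    intro i
    induction i with
    | zero =>
      intro k
      exact (memLp_two_iff_integrable_sq_norm ((hwm 0 k).mono (ℱ.le 0)).aestronglyMeasurable).mpr (hw0 k)
    | succ i ih =>
      intro k
      have : w (i+1) k = fun ω => ∑ l, A l k • ψ (i+1) l ω :=
        funext fun ω => hupd2 (i+1) k ω (by omega)
      rw [this]
      exact memLp_finsetSum _ fun l _ => (hψ2 i l (ih l)).const_smul (A l k)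
  let V : ℕ → Ω → ℝ := fun i ω => ∑ k, p k * ‖w i k ω - wo‖ ^ 2
  have hV0 : ∀ i ω, 0 ≤ V i ω := fun i ω =>
    Finset.sum_nonneg fun k _ => mul_nonneg (hp k).le (sq_nonneg _)
  have hVi : ∀ i, Integrable (V i) P := fun i => integrable_finsetSum _ fun k _ =>
    (((hw2 i k).sub (memLp_const wo)).integrable_norm_pow (by norm_num)).const_mul (p k)
  have hVa : StronglyAdapted ℱ V := fun i =>
    Finset.stronglyMeasurable_fun_sum _ fun k _ =>
      (((hwm i k).sub stronglyMeasurable_const).norm.pow 2).const_mul (p k)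
  have hμsq' : Summable fun i => (μs (i+1)) ^ 2 := (summable_nat_add_iff 1).mpr hμsq
  have hstep : ∀ i, P[V (i+1) | ℱ i] ≤ᵐ[P] fun ω =>
      (1 + (lmax ^ 2 + α) * μs (i+1) ^ 2 - 2 * lmin * μs (i+1)) * V i ω
        + μs (i+1) ^ 2 * (σv2 * ∑ k, p k) := by
    intro i
    set μ := μs (i+1) with hμ
    have hμp : 0 < μ := hμpos (i+1) (by omega)
    let D : Fin N → Ω → EuclideanSpace ℝ (Fin M) := fun l ω =>
      (w i l ω - wo) - μ • gradient J (w i l ω)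
    let T : Fin N → Ω → ℝ := fun l ω => ‖D l ω - μ • v (i+1) l ω‖ ^ 2
    have hDT : ∀ l ω, ψ (i+1) l ω - wo = D l ω - μ • v (i+1) l ω := by
      intro l ω
      rw [hψ]
      simp only [D, smul_add]
      abel
    have hD2 : ∀ l, MemLp (D l) 2 P := fun l =>
      ((hw2 i l).sub (memLp_const wo)).sub ((hg2 i l (hw2 i l)).const_smul μ)
    have hTi : ∀ l, Integrable (T l) P := fun l =>
      ((hD2 l).sub ((hv2 i l).const_smul μ)).integrable_norm_pow (by norm_num)
    have hVT : ∀ ω, V (i+1) ω ≤ (∑ l, p l • T l) ω := by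
      intro ω
      have h1 : ∀ k, p k * ‖w (i+1) k ω - wo‖ ^ 2 ≤ p k * ∑ l, A l k * T l ω := by
        intro k
        refine mul_le_mul_of_nonneg_left ?_ (hp k).le
        rw [hupd2 (i+1) k ω (by omega)]
        refine (ds_jensen (fun l => A l k) (fun l => hA0 l k) (hA1 k) (fun l => ψ (i+1) l ω) wo).trans ?_
        simp only [hDT]
        exact le_rfl
      refine (Finset.sum_le_sum fun k _ => h1 k).trans (le_of_eq ?_)
      simp only [Finset.sum_apply, Pi.smul_apply, smul_eq_mul, Finset.mul_sum]
      rw [Finset.sum_comm]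
      refine Finset.sum_congr rfl fun l _ => ?_
      rw [← hAp l, Finset.sum_mul]
      exact Finset.sum_congr rfl fun k _ => by ring
    have hTsum : Integrable (∑ l, p l • T l) P := integrable_finsetSum' _ fun l _ => (hTi l).smul (p l)
    have c1 : P[V (i+1) | ℱ i] ≤ᵐ[P] P[∑ l, p l • T l | ℱ i] :=
      condExp_mono (hVi (i+1)) hTsum (ae_of_all _ hVT)
    have c2 := condExp_finsetSum (μ := P) (s := Finset.univ) (f := fun l => p l • T l)
      (fun l _ => (hTi l).smul (p l)) (ℱ i)
    have c3 : ∀ᵐ ω ∂P, ∀ l, (P[p l • T l | ℱ i]) ω = p l * (P[T l | ℱ i]) ω := by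
      rw [ae_all_iff]
      intro l
      filter_upwards [condExp_smul (μ := P) (p l) (T l) (ℱ i)] with ω h
      rw [h]; rfl
    have c4 : ∀ᵐ ω ∂P, ∀ l, (P[T l | ℱ i]) ω ≤
        (1 + (lmax ^ 2 + α) * μ ^ 2 - 2 * lmin * μ) * ‖w i l ω - wo‖ ^ 2 + μ ^ 2 * σv2 := by
      rw [ae_all_iff]
      intro l
      have hDm : StronglyMeasurable[ℱ i] (D l) :=
        ((hwm i l).sub stronglyMeasurable_const).sub
          ((hGc.comp_stronglyMeasurable (hwm i l)).const_smul μ)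
      have := ds_step P (ℱ i) (ℱ.le i) (D l) (v (i+1) l) μ _ hDm (hD2 l) (hv2 i l)
        (hvmean (i+1) l (by omega)) (hvvar (i+1) l (by omega))
      filter_upwards [this] with ω hω
      refine hω.trans ?_
      simp only [Nat.add_sub_cancel]
      rw [norm_sub_rev wo]
      obtain ⟨g1, g2⟩ := hG (w i l ω)
      have g3 : ‖gradient J (w i l ω)‖ ^ 2 ≤ lmax ^ 2 * ‖w i l ω - wo‖ ^ 2 := by
        rw [← mul_pow]; gcongr
      have g4 : ‖D l ω‖ ^ 2 = ‖w i l ω - wo‖ ^ 2 - 2 * (μ * ⟪w i l ω - wo, gradient J (w i l ω)⟫)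
          + μ ^ 2 * ‖gradient J (w i l ω)‖ ^ 2 := by
        simp only [D]
        rw [norm_sub_sq_real, real_inner_smul_right, norm_smul, mul_pow, Real.norm_eq_abs, sq_abs]
      rw [g4]
      have g5 := mul_le_mul_of_nonneg_left g3 (sq_nonneg μ)
      have g6 := mul_le_mul_of_nonneg_left g2 hμp.le
      linarith
    filter_upwards [c1, c2, c3, c4] with ω h1 h2 h3 h4
    refine h1.trans ?_
    rw [h2, Finset.sum_apply]
    simp only [V, Finset.mul_sum]
    rw [← Finset.sum_add_distrib]
    refine Finset.sum_le_sum fun l _ => ?_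
    rw [h3 l]
    have := mul_le_mul_of_nonneg_left (h4 l) (hp l).le
    linarith
  have hmain := ds_rs P ℱ V (fun i => (lmax ^ 2 + α) * μs (i+1) ^ 2)
    (fun i => μs (i+1) ^ 2 * (σv2 * ∑ k, p k)) (fun i => 2 * lmin * μs (i+1)) hV0 hVi hVa
    (fun i => by positivity)
    (fun i => mul_nonneg (sq_nonneg _) (mul_nonneg hσ.le (Finset.sum_nonneg fun k _ => (hp k).le)))
    (fun i => mul_nonneg (by positivity) (hμpos (i+1) (by omega)).le)
    (hμsq'.mul_left _) (hμsq'.mul_right _)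
    (by
      intro hs
      have hs' : Summable fun i => μs (i+1) := (summable_mul_left_iff (by positivity)).mp hs
      have ht := hs'.hasSum.tendsto_sum_nat
      refine not_tendsto_nhds_of_tendsto_atTop hμsum _ (ht.congr fun n => ?_)
      rw [Finset.range_eq_Ico, Finset.sum_Ico_add' μs 0 n 1]
      rfl)
    hstep
  filter_upwards [hmain] with ω hω
  rw [tendsto_iff_norm_sub_tendsto_zero]
  have h1 : Tendsto (fun i => ‖w i k0 ω - wo‖ ^ 2) atTop (𝓝 0) := by
    refine squeeze_zero (g := fun i => (p k0)⁻¹ * V i ω) (fun i => sq_nonneg _) (fun i => ?_) (by simpa using hω.const_mul (p k0)⁻¹)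
    rw [le_inv_mul_iff₀ (hp k0)]
    exact Finset.single_le_sum (f := fun k => p k * ‖w i k ω - wo‖ ^ 2)
      (fun k _ => mul_nonneg (hp k).le (sq_nonneg _)) (Finset.mem_univ k0)
  have h2 := h1.sqrt
  simpa [Real.sqrt_sq] using h2
end

section
/- Diffusion outperforms consensus asymptotically (Theorem 4, deterministic form): Let A be an N×N symmetric doubly-stochastic primitive matrix; let H be a real symmetric M×M matrix with λmin·I ⪯ H ⪯ λmax·I, 0 < λmin ≤ λmax; let R_v be a real symmetric positive-semidefinite M×M matrix; let μ > 1/(2λmin) and μ(t) := μ/t. Set 𝒜 := A ⊗ I_M, ℋ := I_N ⊗ H, ℛ_v := I_N ⊗ R_v, and define for t ≥ 1: B_t^{diff} := 𝒜ᵀ(I_{MN} − μ(t)ℋ), B_t^{cons} := 𝒜ᵀ − μ(t)ℋ, G^{diff} := 𝒜ᵀ ℛ_v 𝒜, G^{cons} := ℛ_v. For each algorithm define the network excess-risk ER(i) := (1/(2N)) ∑_{j=1}^{i−1} μ(j)² Tr( (I_N ⊗ H) (∏_{t=j+1}^{i−1} B_tᵀ)ᵀ G (∏_{t=j+1}^{i−1}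 B_tᵀ) ), using (B_t^{diff}, G^{diff}) for ER^{diff}(i) and (B_t^{cons}, G^{cons}) for ER^{cons}(i). Then liminf_{i→∞} i² · ( ER^{cons}(i) − ER^{diff}(i) ) ≥ 0; in particular ER^{diff}(i) ≤ ER^{cons}(i) + o(i^{−2}) as i → ∞. -/
open Matrix Kronecker Filter Topology

/-- The ordered product `B_{j+1}ᵀ B_{j+2}ᵀ ⋯ B_{i−1}ᵀ` of the transposes of a family of
matrices. -/
noncomputable def prodBT {n : Type*} [Fintype n] [DecidableEq n]
    (B : ℕ → Matrix n n ℝ) (j i : ℕ) : Matrix n n ℝ :=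
  ((List.range (i - 1 - j)).map fun t => (B (j + 1 + t))ᵀ).prod

/-- The network excess-risk
`ER(i) = (1/(2N)) ∑_{j=1}^{i−1} μ(j)² Tr((I_N ⊗ H)(∏_{t=j+1}^{i−1} B_tᵀ)ᵀ G (∏_{t=j+1}^{i−1} B_tᵀ))`
associated with an algorithm having iteration matrices `B_t` and noise matrix `G`. -/
noncomputable def networkER {N M : ℕ} (H : Matrix (Fin M) (Fin M) ℝ) (μ : ℝ)
    (B : ℕ → Matrix (Fin N × Fin M) (Fin N × Fin M) ℝ)
    (G : Matrix (Fin N × Fin M) (Fin N × Fin M) ℝ) (i : ℕ) : ℝ :=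
  (1 / (2 * (N : ℝ))) * ∑ j ∈ Finset.Icc 1 (i - 1), (μ / (j : ℝ)) ^ 2 *
    (((1 : Matrix (Fin N) (Fin N) ℝ) ⊗ₖ H) * (prodBT B j i)ᵀ * G * prodBT B j i).trace

lemma exists_diag {n : Type*} [Fintype n] [DecidableEq n] (A : Matrix n n ℝ) (hA : A.IsSymm) :
    ∃ (U : Matrix n n ℝ) (d : n → ℝ), Uᵀ * U = 1 ∧ U * Uᵀ = 1 ∧ A = U * diagonal d * Uᵀ := by
  have hH : A.IsHermitian := by
    rw [Matrix.IsHermitian, conjTranspose_eq_transpose_of_trivial]; exact hA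
  refine ⟨hH.eigenvectorUnitary, hH.eigenvalues, ?_, ?_, ?_⟩
  · have := Unitary.coe_star_mul_self hH.eigenvectorUnitary
    rwa [star_eq_conjTranspose, conjTranspose_eq_transpose_of_trivial] at this
  · rw [mul_eq_one_comm]
    have := Unitary.coe_star_mul_self hH.eigenvectorUnitary
    rwa [star_eq_conjTranspose, conjTranspose_eq_transpose_of_trivial] at this
  · have := hH.spectral_theorem
    rw [Unitary.conjStarAlgAut_apply] at this
    rwa [star_eq_conjTranspose, conjTranspose_eq_transpose_of_trivial] at this

lemma rec_tendsto (x c d : ℕ → ℝ) (c0 d0 : ℝ) (hc0 : |c0| < 1)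
    (hc : Tendsto c atTop (𝓝 c0)) (hd : Tendsto d atTop (𝓝 d0))
    (hx : ∀ᶠ n in atTop, x (n+1) = c n * x n + d n) :
    Tendsto x atTop (𝓝 (d0 / (1 - c0))) := by
  set L := d0 / (1 - c0) with hL
  have h1 : (1 - c0) ≠ 0 := by
    have := (abs_lt.1 hc0).2; linarith
  have hLe : c0 * L + d0 - L = 0 := by rw [hL]; field_simp; ring
  obtain ⟨q, hq1, hq2⟩ := exists_between hc0
  have hq0 : 0 ≤ q := (abs_nonneg _).trans hq1.le
  have he : Tendsto (fun n => |c n * L + d n - L|) atTop (𝓝 0) := by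
    have := (((hc.mul_const L).add hd).sub_const L).abs
    rwa [hLe, abs_zero] at this
  have hcq : ∀ᶠ n in atTop, |c n| < q := hc.abs.eventually (gt_mem_nhds hq1)
  rw [Metric.tendsto_atTop]
  intro ε hε
  have hδ : 0 < (1 - q) * (ε / 2) := by
    have : 0 < 1 - q := by linarith
    positivity
  have hall := (hx.and hcq).and (he.eventually (gt_mem_nhds hδ))
  obtain ⟨n0, hn0⟩ := eventually_atTop.1 hall
  have hb : ∀ k, |x (n0 + k) - L| ≤ q ^ k * |x n0 - L| + ε / 2 := by
    intro k
    induction k with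
    | zero => simp; linarith
    | succ k ih =>
      obtain ⟨⟨e1, e2⟩, e3⟩ := hn0 (n0 + k) (by omega)
      have : x (n0 + (k+1)) - L = c (n0+k) * (x (n0+k) - L) + (c (n0+k) * L + d (n0+k) - L) := by
        rw [← add_assoc, e1]; ring
      rw [this]
      calc _ ≤ |c (n0+k)| * |x (n0+k) - L| + |c (n0+k) * L + d (n0+k) - L| := by
            rw [← abs_mul]; exact abs_add_le _ _
        _ ≤ q * (q ^ k * |x n0 - L| + ε / 2) + (1 - q) * (ε / 2) := by
            gcongr
        _ = _ := by ring
  have hpow : Tendsto (fun k : ℕ => q ^ k * |x n0 - L|) atTop (𝓝 0) := by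
    simpa using (tendsto_pow_atTop_nhds_zero_of_lt_one hq0 hq2).mul_const (|x n0 - L|)
  obtain ⟨k0, hk0⟩ := eventually_atTop.1 (hpow.eventually (gt_mem_nhds (half_pos hε)))
  refine ⟨n0 + k0, fun n hn => ?_⟩
  obtain ⟨k, rfl⟩ := Nat.exists_eq_add_of_le (show n0 ≤ n by omega)
  have := hk0 k (by omega)
  have := hb k
  rw [Real.dist_eq]
  linarith

/-- scalar sum -/
noncomputable def scalS (b : ℕ → ℝ) (i : ℕ) : ℝ :=
  ∑ j ∈ Finset.Icc 1 (i - 1), (1 / (j : ℝ)) ^ 2 * (∏ t ∈ Finset.Ico (j+1) i, b t) ^ 2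

lemma scalS_tendsto (b : ℕ → ℝ) (a : ℝ) (ha : |a| < 1) (hb : Tendsto b atTop (𝓝 a)) :
    Tendsto (fun i : ℕ => (i : ℝ) ^ 2 * scalS b i) atTop (𝓝 (1 / (1 - a ^ 2))) := by
  have hr : Tendsto (fun n : ℕ => (((n : ℝ) + 1) / n) ^ 2) atTop (𝓝 1) := by
    have h := (tendsto_one_div_atTop_nhds_zero_nat (𝕜 := ℝ)).const_add 1
    have h2 := h.pow 2
    simp only [add_zero, one_pow] at h2
    refine h2.congr' ?_
    filter_upwards [eventually_ge_atTop 1] with n hn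
    have : (n : ℝ) ≠ 0 := by positivity
    field_simp
  refine rec_tendsto _ (fun n => ((((n : ℝ) + 1) / n) ^ 2) * b n ^ 2) _ _ _ ?_ ?_ hr ?_
  · rw [abs_pow]; exact pow_lt_one₀ (abs_nonneg _) ha (by norm_num)
  · simpa using hr.mul (hb.pow 2)
  · filter_upwards [eventually_ge_atTop 1] with n hn
    obtain ⟨m, rfl⟩ := Nat.exists_eq_add_of_le' hn
    have key : scalS b (m + 1 + 1) = b (m+1) ^ 2 * scalS b (m+1) + (1 / ((m + 1 : ℕ) : ℝ)) ^ 2 := by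
      unfold scalS
      simp only [Nat.add_sub_cancel]
      rw [Finset.sum_Icc_succ_top (by omega), Finset.mul_sum]
      congr 1
      · refine Finset.sum_congr rfl fun j hj => ?_
        have := Finset.mem_Icc.1 hj
        rw [Finset.prod_Ico_succ_top (by omega)]; ring
      · simp
    have h0 : ((m + 1 : ℕ) : ℝ) ≠ 0 := by positivity
    rw [key]
    push_cast at h0 ⊢
    field_simp

lemma eig_bound {N : ℕ} (A : Matrix (Fin N) (Fin N) ℝ) 
    (hA0 : ∀ l k, 0 ≤ A l k) (hArow : ∀ l, ∑ k, A l k = 1) 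
    (hAprim : ∃ m : ℕ, 1 ≤ m ∧ ∀ l k, 0 < (A ^ m) l k)
    (v : Fin N → ℝ) (hv : v ≠ 0) (a : ℝ) (hav : A *ᵥ v = a • v) : a = 1 ∨ |a| < 1 := by
  obtain ⟨p, hp⟩ := Function.ne_iff.1 hv
  have : Nonempty (Fin N) := ⟨p⟩
  obtain ⟨l, -, hl⟩ := Finset.exists_max_image Finset.univ (fun k => |v k|) ⟨p, Finset.mem_univ _⟩
  have hlpos : 0 < |v l| := (abs_pos.2 hp).trans_le (hl p (Finset.mem_univ _))
  have hle : |a| ≤ 1 := by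
    have h := congrFun hav l
    simp only [mulVec, dotProduct, Pi.smul_apply, smul_eq_mul] at h
    have : |a| * |v l| ≤ 1 * |v l| := by
      rw [← abs_mul, ← h, ← hArow l, Finset.sum_mul]
      refine (Finset.abs_sum_le_sum_abs _ _).trans (Finset.sum_le_sum fun k _ => ?_)
      rw [abs_mul, abs_of_nonneg (hA0 l k)]
      exact mul_le_mul_of_nonneg_left (hl k (Finset.mem_univ _)) (hA0 l k)
    exact le_of_mul_le_mul_right this hlpos
  rcases lt_or_eq_of_le hle with h | h
  · exact Or.inr h
  rcases eq_or_eq_neg_of_abs_eq h with h | h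
  · exact Or.inl h
  exfalso
  subst h
  obtain ⟨m, hm, hpos⟩ := hAprim
  have hpow : ∀ k, (A ^ k) *ᵥ v = ((-1 : ℝ) ^ k) • v := by
    intro k
    induction k with
    | zero => simp
    | succ k ih => rw [pow_succ, ← mulVec_mulVec, hav, mulVec_smul, ih, smul_smul, pow_succ]; ring_nf
  have hone : ∀ k, (A ^ k) *ᵥ (fun _ => (1:ℝ)) = fun _ => 1 := by
    intro k
    induction k with
    | zero => simp
    | succ k ih =>
      rw [pow_succ, ← mulVec_mulVec]
      have : A *ᵥ (fun _ => (1:ℝ)) = fun _ => 1 := by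
        ext l; simp [mulVec, dotProduct, hArow]
      rw [this, ih]
  have hP : ∀ l k, 0 < (A ^ (m + m)) l k := by
    intro l k
    rw [pow_add, mul_apply]
    exact Finset.sum_pos (fun x _ => mul_pos (hpos _ _) (hpos _ _)) Finset.univ_nonempty
  have hPv := hpow (m + m)
  rw [Even.neg_one_pow ⟨m, rfl⟩, one_smul] at hPv
  obtain ⟨q, -, hq⟩ := Finset.exists_max_image Finset.univ v ⟨p, Finset.mem_univ _⟩
  have h1 := congrFun hPv q
  have h2 := congrFun (hone (m+m)) q
  simp only [mulVec, dotProduct, mul_one] at h1 h2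
  have hz : ∑ k, (A ^ (m+m)) q k * (v q - v k) = 0 := by
    simp only [mul_sub, Finset.sum_sub_distrib, ← Finset.sum_mul, h1, h2]; ring
  rw [Finset.sum_eq_zero_iff_of_nonneg (fun k _ => mul_nonneg (hP _ _).le
    (sub_nonneg.2 (hq k (Finset.mem_univ _))))] at hz
  have hc : ∀ k, v k = v q := by
    intro k
    have := (mul_eq_zero.1 (hz k (Finset.mem_univ _))).resolve_left (hP _ _).ne'
    linarith
  have h := congrFun hav q
  simp only [mulVec, dotProduct, Pi.smul_apply, smul_eq_mul, hc, ← Finset.sum_mul, hArow] at h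
  apply hp
  rw [hc p]; simp; linarith

lemma prodBT_diag {n : Type*} [Fintype n] [DecidableEq n] (W : Matrix n n ℝ)
    (h1 : Wᵀ * W = 1) (h2 : W * Wᵀ = 1) (B : ℕ → Matrix n n ℝ) (b : ℕ → n → ℝ)
    (hB : ∀ t, B t = W * diagonal (b t) * Wᵀ) (j i : ℕ) :
    prodBT B j i = W * diagonal (fun p => ∏ t ∈ Finset.Ico (j+1) i, b t p) * Wᵀ := by
  have hBT : ∀ t, (B t)ᵀ = W * diagonal (b t) * Wᵀ := by
    intro t; rw [hB]; simp [transpose_mul, Matrix.mul_assoc]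
  have key : ∀ k, ((List.range k).map fun t => (B (j + 1 + t))ᵀ).prod =
      W * diagonal (fun p => ∏ t ∈ Finset.range k, b (j + 1 + t) p) * Wᵀ := by
    intro k
    induction k with
    | zero => simp [h2]
    | succ k ih =>
      rw [List.range_succ, List.map_append, List.prod_append, ih]
      simp only [List.map_cons, List.map_nil, List.prod_singleton, hBT]
      calc _ = W * diagonal (fun p => ∏ t ∈ Finset.range k, b (j + 1 + t) p) * (Wᵀ * W) *
            diagonal (b (j+1+k)) * Wᵀ := by simp only [Matrix.mul_assoc]
        _ = _ := by
          rw [h1, Matrix.mul_one, Matrix.mul_assoc W, diagonal_mul_diagonal]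
          simp only [Finset.prod_range_succ]
  unfold prodBT
  rw [key]
  simp only [Finset.prod_Ico_eq_prod_range]
  rw [show i - 1 - j = i - (j + 1) by omega]

lemma trace_diag {n : Type*} [Fintype n] [DecidableEq n] (W : Matrix n n ℝ)
    (h1 : Wᵀ * W = 1) (G : Matrix n n ℝ) (e c : n → ℝ) :
    ((W * diagonal e * Wᵀ) * (W * diagonal c * Wᵀ)ᵀ * G * (W * diagonal c * Wᵀ)).trace
      = ∑ p, e p * c p ^ 2 * (Wᵀ * G * W) p p := by
  have hT : (W * diagonal c * Wᵀ)ᵀ = W * diagonal c * Wᵀ := by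
    simp [transpose_mul, Matrix.mul_assoc]
  rw [hT]
  have : (W * diagonal e * Wᵀ) * (W * diagonal c * Wᵀ) * G * (W * diagonal c * Wᵀ) =
      W * (diagonal (fun p => e p * c p) * (Wᵀ * G * W) * diagonal c * Wᵀ) := by
    calc _ = W * diagonal e * (Wᵀ * W) * diagonal c * Wᵀ * G * (W * diagonal c * Wᵀ) := by
            simp only [Matrix.mul_assoc]
      _ = _ := by
        rw [h1, Matrix.mul_one, Matrix.mul_assoc W (diagonal e), diagonal_mul_diagonal]
        simp only [Matrix.mul_assoc]
  rw [this, trace_mul_comm, Matrix.mul_assoc, h1, Matrix.mul_one, Matrix.trace]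
  refine Finset.sum_congr rfl fun p _ => ?_
  simp only [diag_apply, mul_diagonal, diagonal_mul]
  ring

lemma networkER_diag {N M : ℕ} (H : Matrix (Fin M) (Fin M) ℝ) (μ : ℝ)
    (W : Matrix (Fin N × Fin M) (Fin N × Fin M) ℝ)
    (h1 : Wᵀ * W = 1) (h2 : W * Wᵀ = 1)
    (B : ℕ → Matrix (Fin N × Fin M) (Fin N × Fin M) ℝ) (b : ℕ → Fin N × Fin M → ℝ)
    (hB : ∀ t, B t = W * diagonal (b t) * Wᵀ) (e : Fin N × Fin M → ℝ)
    (he : (1 : Matrix (Fin N) (Fin N) ℝ) ⊗ₖ H = W * diagonal e * Wᵀ)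
    (G : Matrix (Fin N × Fin M) (Fin N × Fin M) ℝ) (i : ℕ) :
    networkER H μ B G i = (1 / (2 * (N : ℝ))) * ∑ p, μ ^ 2 * e p * (Wᵀ * G * W) p p *
      scalS (fun t => b t p) i := by
  unfold networkER scalS
  congr 1
  simp only [Finset.mul_sum]
  rw [Finset.sum_comm]
  refine Finset.sum_congr rfl fun j _ => ?_
  rw [prodBT_diag W h1 h2 B b hB, he, trace_diag W h1, Finset.mul_sum]
  refine Finset.sum_congr rfl fun p _ => ?_
  ring

/-- **Diffusion outperforms consensus asymptotically** (Theorem 4, deterministic form):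
`liminf_{i→∞} i² (ER^{cons}(i) − ER^{diff}(i)) ≥ 0`. -/
theorem diffusion_outperforms_consensus {N M : ℕ}
    (A : Matrix (Fin N) (Fin N) ℝ) (hAsymm : A.IsSymm)
    (hA0 : ∀ l k, 0 ≤ A l k)
    (hArow : ∀ l, ∑ k, A l k = 1) (hAcol : ∀ k, ∑ l, A l k = 1)
    (hAprim : ∃ m : ℕ, 1 ≤ m ∧ ∀ l k, 0 < (A ^ m) l k)
    (H : Matrix (Fin M) (Fin M) ℝ) (hHsymm : H.IsSymm)
    (lmin lmax : ℝ) (hlmin : 0 < lmin) (hlle : lmin ≤ lmax)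
    (hlow : ∀ v : Fin M → ℝ, lmin * (v ⬝ᵥ v) ≤ v ⬝ᵥ (H *ᵥ v))
    (hhigh : ∀ v : Fin M → ℝ, v ⬝ᵥ (H *ᵥ v) ≤ lmax * (v ⬝ᵥ v))
    (Rv : Matrix (Fin M) (Fin M) ℝ) (hRv : Rv.PosSemidef)
    (μ : ℝ) (hμ : 1 / (2 * lmin) < μ) :
    0 ≤ liminf (fun i : ℕ => (i : ℝ) ^ 2 *
      (networkER H μ
          (fun t => (A ⊗ₖ (1 : Matrix (Fin M) (Fin M) ℝ))ᵀ -
            (μ / (t : ℝ)) • ((1 : Matrix (Fin N) (Fin N) ℝ) ⊗ₖ H))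
          ((1 : Matrix (Fin N) (Fin N) ℝ) ⊗ₖ Rv) i -
        networkER H μ
          (fun t => (A ⊗ₖ (1 : Matrix (Fin M) (Fin M) ℝ))ᵀ *
            ((1 : Matrix (Fin N × Fin M) (Fin N × Fin M) ℝ) -
              (μ / (t : ℝ)) • ((1 : Matrix (Fin N) (Fin N) ℝ) ⊗ₖ H)))
          ((A ⊗ₖ (1 : Matrix (Fin M) (Fin M) ℝ))ᵀ *
            ((1 : Matrix (Fin N) (Fin N) ℝ) ⊗ₖ Rv) *
            (A ⊗ₖ (1 : Matrix (Fin M) (Fin M) ℝ))) i))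
      atTop := by
  obtain ⟨U, a, hU1, hU2, hUA⟩ := exists_diag A hAsymm
  obtain ⟨V, h, hV1, hV2, hVH⟩ := exists_diag H hHsymm
  have hAU : A * U = U * diagonal a := by
    rw [hUA, Matrix.mul_assoc _ Uᵀ U, hU1, Matrix.mul_one]
  have hHV : Vᵀ * H * V = diagonal h := by
    rw [hVH]
    calc _ = (Vᵀ * V) * diagonal h * (Vᵀ * V) := by simp only [Matrix.mul_assoc]
      _ = _ := by rw [hV1]; simp
  have ha : ∀ k, a k = 1 ∨ |a k| < 1 := by
    intro k
    refine eig_bound A hA0 hArow hAprim (fun l => U l k) ?_ (a k) ?_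
    · intro h0
      have := congrFun (congrFun hU1 k) k
      rw [mul_apply] at this
      simp only [transpose_apply] at this
      simp [fun l => congrFun h0 l] at this
    · ext l
      have := congrFun (congrFun hAU l) k
      rw [mul_diagonal, mul_apply] at this
      simp only [mulVec, dotProduct, this, Pi.smul_apply, smul_eq_mul]
      ring
  have hh : ∀ m, 0 ≤ h m := by
    intro m
    have e1 : h m = (fun l => V l m) ⬝ᵥ (H *ᵥ (fun l => V l m)) := by
      have := congrFun (congrFun hHV m) m
      rw [diagonal_apply_eq, Matrix.mul_assoc, mul_apply] at this
      rw [← this]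
      simp only [transpose_apply, dotProduct, mulVec, mul_apply]
    rw [e1]
    refine le_trans (mul_nonneg hlmin.le ?_) (hlow _)
    exact Finset.sum_nonneg fun _ _ => mul_self_nonneg _
  have hr : ∀ m, 0 ≤ (Vᵀ * Rv * V) m m := by
    intro m
    have := hRv.conjTranspose_mul_mul_same V
    rw [conjTranspose_eq_transpose_of_trivial] at this
    exact this.diag_nonneg
  set W := U ⊗ₖ V with hW
  have hWT : Wᵀ = Uᵀ ⊗ₖ Vᵀ := by rw [hW, kroneckerMap_transpose]
  have hW1 : Wᵀ * W = 1 := by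
    rw [hWT, hW, ← mul_kronecker_mul, hU1, hV1, one_kronecker_one]
  have hW2 : W * Wᵀ = 1 := by
    rw [hWT, hW, ← mul_kronecker_mul, hU2, hV2, one_kronecker_one]
  have hIH : (1 : Matrix (Fin N) (Fin N) ℝ) ⊗ₖ H =
      W * diagonal (fun p : Fin N × Fin M => h p.2) * Wᵀ := by
    have : diagonal (fun p : Fin N × Fin M => h p.2) =
        (1 : Matrix (Fin N) (Fin N) ℝ) ⊗ₖ diagonal h := by
      rw [← diagonal_one, diagonal_kronecker_diagonal]; simp
    rw [this, hWT, hW, ← mul_kronecker_mul, ← mul_kronecker_mul, Matrix.mul_one, hU2, ← hVH]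
  have hAI : A ⊗ₖ (1 : Matrix (Fin M) (Fin M) ℝ) =
      W * diagonal (fun p : Fin N × Fin M => a p.1) * Wᵀ := by
    have : diagonal (fun p : Fin N × Fin M => a p.1) =
        diagonal a ⊗ₖ (1 : Matrix (Fin M) (Fin M) ℝ) := by
      rw [← diagonal_one, diagonal_kronecker_diagonal]; simp
    rw [this, hWT, hW, ← mul_kronecker_mul, ← mul_kronecker_mul, Matrix.mul_one, hV2, ← hUA]
  have hAIT : (A ⊗ₖ (1 : Matrix (Fin M) (Fin M) ℝ))ᵀ =
      W * diagonal (fun p : Fin N × Fin M => a p.1) * Wᵀ := by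
    rw [hAI]; simp [transpose_mul, Matrix.mul_assoc]
  have hBc : ∀ t : ℕ, (A ⊗ₖ (1 : Matrix (Fin M) (Fin M) ℝ))ᵀ -
            (μ / (t : ℝ)) • ((1 : Matrix (Fin N) (Fin N) ℝ) ⊗ₖ H) =
      W * diagonal (fun p : Fin N × Fin M => a p.1 - μ / (t : ℝ) * h p.2) * Wᵀ := by
    intro t
    have : diagonal (fun p : Fin N × Fin M => a p.1 - μ / (t : ℝ) * h p.2) =
      diagonal (fun p : Fin N × Fin M => a p.1) -
        (μ / (t : ℝ)) • diagonal (fun p : Fin N × Fin M => h p.2) := by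
      rw [← diagonal_smul, ← diagonal_sub]; rfl
    rw [this, hAIT, hIH, Matrix.mul_sub, Matrix.sub_mul, Matrix.mul_smul, Matrix.smul_mul]
  have hBd : ∀ t : ℕ, (A ⊗ₖ (1 : Matrix (Fin M) (Fin M) ℝ))ᵀ *
            ((1 : Matrix (Fin N × Fin M) (Fin N × Fin M) ℝ) -
              (μ / (t : ℝ)) • ((1 : Matrix (Fin N) (Fin N) ℝ) ⊗ₖ H)) =
      W * diagonal (fun p : Fin N × Fin M => a p.1 * (1 - μ / (t : ℝ) * h p.2)) * Wᵀ := by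
    intro t
    have e1 : diagonal (fun p : Fin N × Fin M => a p.1 * (1 - μ / (t : ℝ) * h p.2)) =
      diagonal (fun p : Fin N × Fin M => a p.1) * (1 -
        (μ / (t : ℝ)) • diagonal (fun p : Fin N × Fin M => h p.2)) := by
      rw [← diagonal_smul, ← diagonal_one, diagonal_sub, diagonal_mul_diagonal]; rfl
    have e2 : (1 : Matrix (Fin N × Fin M) (Fin N × Fin M) ℝ) -
        (μ / (t : ℝ)) • (W * diagonal (fun p : Fin N × Fin M => h p.2) * Wᵀ) =
        W * (1 - (μ / (t : ℝ)) • diagonal (fun p : Fin N × Fin M => h p.2)) * Wᵀ := by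
      rw [Matrix.mul_sub, Matrix.sub_mul, Matrix.mul_smul, Matrix.smul_mul, Matrix.mul_one, hW2]
    rw [e1, hAIT, hIH, e2]
    generalize (1 - (μ / (t : ℝ)) • diagonal (fun p : Fin N × Fin M => h p.2)) = X
    calc _ = W * diagonal (fun p : Fin N × Fin M => a p.1) * (Wᵀ * W) * X * Wᵀ := by
          simp only [Matrix.mul_assoc]
      _ = _ := by rw [hW1, Matrix.mul_one]; simp only [Matrix.mul_assoc]
  have hGc : Wᵀ * ((1 : Matrix (Fin N) (Fin N) ℝ) ⊗ₖ Rv) * W =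
      (1 : Matrix (Fin N) (Fin N) ℝ) ⊗ₖ (Vᵀ * Rv * V) := by
    rw [hWT, hW, ← mul_kronecker_mul, ← mul_kronecker_mul, Matrix.mul_one, hU1]
  have hGd : Wᵀ * ((A ⊗ₖ (1 : Matrix (Fin M) (Fin M) ℝ))ᵀ *
            ((1 : Matrix (Fin N) (Fin N) ℝ) ⊗ₖ Rv) *
            (A ⊗ₖ (1 : Matrix (Fin M) (Fin M) ℝ))) * W =
      diagonal (fun p : Fin N × Fin M => a p.1) *
        ((1 : Matrix (Fin N) (Fin N) ℝ) ⊗ₖ (Vᵀ * Rv * V)) *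
        diagonal (fun p : Fin N × Fin M => a p.1) := by
    rw [← hGc, hAIT, hAI]
    generalize (1 : Matrix (Fin N) (Fin N) ℝ) ⊗ₖ Rv = X
    generalize diagonal (fun p : Fin N × Fin M => a p.1) = D
    calc _ = (Wᵀ * W) * D * Wᵀ * X * W * D * (Wᵀ * W) := by simp only [Matrix.mul_assoc]
      _ = _ := by rw [hW1]; simp only [Matrix.mul_assoc, Matrix.mul_one, Matrix.one_mul]
  have hlim : ∀ x : ℝ, Tendsto (fun t : ℕ => μ / (t : ℝ) * x) atTop (𝓝 0) := by
    intro x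
    simpa using (tendsto_const_div_atTop_nhds_zero_nat μ).mul_const x
  have hterm : ∀ p : Fin N × Fin M, ∃ L : ℝ, 0 ≤ L ∧
      Tendsto (fun i : ℕ => (i : ℝ) ^ 2 * (scalS (fun t => a p.1 - μ / (t : ℝ) * h p.2) i -
        a p.1 ^ 2 * scalS (fun t => a p.1 * (1 - μ / (t : ℝ) * h p.2)) i)) atTop (𝓝 L) := by
    intro p
    rcases ha p.1 with h1 | h1
    · refine ⟨0, le_rfl, ?_⟩
      simp [h1]
    · refine ⟨1, zero_le_one, ?_⟩
      have t1 := scalS_tendsto (fun t => a p.1 - μ / (t : ℝ) * h p.2) _ h1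
        (by simpa using (hlim (h p.2)).const_sub (a p.1))
      have t2 := scalS_tendsto (fun t => a p.1 * (1 - μ / (t : ℝ) * h p.2)) _ h1
        (by simpa using ((hlim (h p.2)).const_sub 1).const_mul (a p.1))
      have hne : 1 - a p.1 ^ 2 ≠ 0 := by
        have := (sq_lt_one_iff_abs_lt_one (a p.1)).2 h1
        linarith
      have t3 := t1.sub (t2.const_mul (a p.1 ^ 2))
      have : 1 / (1 - a p.1 ^ 2) - a p.1 ^ 2 * (1 / (1 - a p.1 ^ 2)) = 1 := by
        field_simp
      rw [this] at t3
      refine t3.congr fun i => ?_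
      ring
  choose L hL0 hL using hterm
  have hfin : Tendsto (fun i : ℕ => (1 / (2 * (N : ℝ))) * ∑ p : Fin N × Fin M,
      μ ^ 2 * h p.2 * (Vᵀ * Rv * V) p.2 p.2 *
      ((i : ℝ) ^ 2 * (scalS (fun t => a p.1 - μ / (t : ℝ) * h p.2) i -
        a p.1 ^ 2 * scalS (fun t => a p.1 * (1 - μ / (t : ℝ) * h p.2)) i))) atTop
      (𝓝 ((1 / (2 * (N : ℝ))) * ∑ p : Fin N × Fin M,
        μ ^ 2 * h p.2 * (Vᵀ * Rv * V) p.2 p.2 * L p)) :=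
    (tendsto_finsetSum _ fun p _ => (hL p).const_mul _).const_mul _
  have hnn : 0 ≤ (1 / (2 * (N : ℝ))) * ∑ p : Fin N × Fin M,
        μ ^ 2 * h p.2 * (Vᵀ * Rv * V) p.2 p.2 * L p := by
    refine mul_nonneg (by positivity) (Finset.sum_nonneg fun p _ => ?_)
    exact mul_nonneg (mul_nonneg (mul_nonneg (sq_nonneg _) (hh _)) (hr _)) (hL0 _)
  refine hnn.trans_eq (Eq.symm (Tendsto.liminf_eq (hfin.congr fun i => ?_)))
  rw [networkER_diag H μ W hW1 hW2 _ _ hBc _ hIH, networkER_diag H μ W hW1 hW2 _ _ hBd _ hIH,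
    hGc, hGd, ← mul_sub, ← Finset.sum_sub_distrib, mul_left_comm]
  congr 1
  rw [Finset.mul_sum]
  refine Finset.sum_congr rfl fun p _ => ?_
  simp only [mul_diagonal, diagonal_mul, kroneckerMap_apply, one_apply_eq]
  ring
end

section
/- Weighted network mean-square-error recursion (intermediate result in the proof of Theorem 1): Assume the diffusion learning model, and let p be the Perron vector of A (Ap = p, entrywise positive, 𝟙ᵀp = 1). Then for every i ≥ 1, almost surely, E[ ∑_{k=1}^N p_k ‖w° − w_{k,i}‖² | ℱ_{i−1} ] ≤ β_i · ∑_{k=1}^N p_k ‖w° − w_{k,i−1}‖² + μ(i)² σ_v², where β_i := 1 − 2μ(i)λmin + μ(i)²(λmax² + α). -/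
open MeasureTheory Filter Topology Matrix RealInnerProductSpace

section helpers

variable {E : Type*} [NormedAddCommGroup E] [InnerProductSpace ℝ E]

/-- A symmetric operator with `0 ≤ T ≤ L` has norm at most `L`. -/
lemma aux_opnorm (T : E →L[ℝ] E) (L : ℝ) (hL : 0 < L)
    (hs : ∀ u v : E, ⟪u, T v⟫ = ⟪T u, v⟫)
    (h0 : ∀ v : E, 0 ≤ ⟪v, T v⟫) (h1 : ∀ v : E, ⟪v, T v⟫ ≤ L * ‖v‖ ^ 2) : ‖T‖ ≤ L := by
  refine T.opNorm_le_bound hL.le fun v => ?_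
  have h := h0 (L • v - T v)
  have e : ⟪L • v - T v, T (L • v - T v)⟫
      = L ^ 2 * ⟪v, T v⟫ - 2 * L * ‖T v‖ ^ 2 + ⟪T v, T (T v)⟫ := by
    simp only [map_sub, map_smul, inner_sub_left, inner_sub_right, inner_smul_left,
      inner_smul_right, RCLike.conj_to_real, hs v (T v), real_inner_self_eq_norm_sq]
    ring
  rw [e] at h
  have h2 := h1 (T v)
  have h3 := h1 v
  have h4 : L * ‖T v‖ ^ 2 ≤ L * (L * ‖v‖) ^ 2 := by nlinarith [sq_nonneg L]
  have h5 : ‖T v‖ ^ 2 ≤ (L * ‖v‖) ^ 2 := le_of_mul_le_mul_left h4 hL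
  exact le_of_sq_le_sq h5 (by positivity)

lemma aux_mono (g : E → E) (hg : Differentiable ℝ g) (c : ℝ)
    (h : ∀ x v : E, c * ‖v‖ ^ 2 ≤ ⟪v, fderiv ℝ g x v⟫) (x y : E) :
    c * ‖x - y‖ ^ 2 ≤ ⟪x - y, g x - g y⟫ := by
  have hd : ∀ t : ℝ, HasDerivAt (fun t : ℝ => ⟪x - y, g (y + t • (x - y))⟫)
      (⟪x - y, fderiv ℝ g (y + t • (x - y)) (x - y)⟫) t := by
    intro t
    have h1 : HasDerivAt (fun t : ℝ => y + t • (x - y)) (x - y) t := by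
      simpa using ((hasDerivAt_id t).smul_const (x - y)).const_add y
    have h2 := (hg (y + t • (x - y))).hasFDerivAt.comp_hasDerivAt t h1
    simpa using (hasDerivAt_const t (x - y)).inner ℝ h2
  obtain ⟨t, -, ht⟩ := exists_hasDerivAt_eq_slope _ _ (zero_lt_one (α := ℝ))
    (fun t _ => (hd t).continuousAt.continuousWithinAt) (fun t _ => hd t)
  have := h (y + t • (x - y)) (x - y)
  rw [ht] at this
  simpa [inner_sub_right] using this

lemma aux_jensen {ι : Type*} [Fintype ι] (a : ι → ℝ) (ha : ∀ l, 0 ≤ a l) (hs : ∑ l, a l = 1)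
    (wo : E) (x : ι → E) :
    ‖wo - ∑ l, a l • x l‖ ^ 2 ≤ ∑ l, a l * ‖wo - x l‖ ^ 2 := by
  have e : wo - ∑ l, a l • x l = ∑ l, a l • (wo - x l) := by
    simp [smul_sub, Finset.sum_sub_distrib, ← Finset.sum_smul, hs]
  rw [e]
  have hc : ConvexOn ℝ Set.univ (fun z : E => ‖z‖ ^ 2) :=
    (convexOn_univ_norm (E := E)).pow (fun _ _ => norm_nonneg _) 2
  simpa using hc.map_sum_le (t := Finset.univ) (w := a) (p := fun l => wo - x l)
    (fun l _ => ha l) hs (fun _ _ => Set.mem_univ _)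

lemma aux_grad [CompleteSpace E] (J : E → ℝ) (hJ : ContDiff ℝ 2 J) :
    Differentiable ℝ (gradient J) ∧
    ∀ x u v : E, ⟪u, fderiv ℝ (gradient J) x v⟫ = ⟪fderiv ℝ (gradient J) x u, v⟫ := by
  have hd : Differentiable ℝ (fderiv ℝ J) :=
    (hJ.fderiv_right (m := 1) (by norm_num)).differentiable (by norm_num)
  let D := (InnerProductSpace.toDual ℝ E).symm.toContinuousLinearEquiv.toContinuousLinearMap
  have hg : ∀ x, HasFDerivAt (gradient J) (D.comp (fderiv ℝ (fderiv ℝ J) x)) x := fun x =>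
    D.hasFDerivAt.comp x (hd x).hasFDerivAt
  refine ⟨fun x => (hg x).differentiableAt, fun x u v => ?_⟩
  rw [(hg x).fderiv]
  have hs : IsSymmSndFDerivAt ℝ J x := hJ.contDiffAt.isSymmSndFDerivAt (by simp)
  have key : ∀ a b : E, ⟪D (fderiv ℝ (fderiv ℝ J) x a), b⟫ = fderiv ℝ (fderiv ℝ J) x a b :=
    fun a b => InnerProductSpace.toDual_symm_apply
  change ⟪u, D (fderiv ℝ (fderiv ℝ J) x v)⟫ = ⟪D (fderiv ℝ (fderiv ℝ J) x u), v⟫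
  rw [real_inner_comm, key, key]
  exact hs.eq v u

end helpers

/-- **Weighted network mean-square-error recursion** (intermediate result in the proof of
Theorem 1): with `p` the Perron vector of `A`, the `p`-weighted network mean-square error
satisfies, almost surely,
`E[ ∑ₖ pₖ‖w° − w_{k,i}‖² | ℱ_{i−1}] ≤ βᵢ ∑ₖ pₖ‖w° − w_{k,i−1}‖² + μ(i)²σᵥ²`
where `βᵢ = 1 − 2μ(i)λmin + μ(i)²(λmax² + α)`. -/
theorem diffusion_weighted_mse_recursion
    {Ω : Type*} [m0 : MeasurableSpace Ω] (P : Measure Ω) [IsProbabilityMeasure P]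
    (ℱ : Filtration ℕ m0)
    {M N : ℕ}
    (J : EuclideanSpace ℝ (Fin M) → ℝ)
    (lmin lmax : ℝ) (hlmin : 0 < lmin) (hlle : lmin ≤ lmax)
    (hJ : ContDiff ℝ 2 J)
    (hHess : ∀ x v : EuclideanSpace ℝ (Fin M),
      lmin * ‖v‖ ^ 2 ≤ ⟪v, fderiv ℝ (gradient J) x v⟫ ∧
      ⟪v, fderiv ℝ (gradient J) x v⟫ ≤ lmax * ‖v‖ ^ 2)
    (wo : EuclideanSpace ℝ (Fin M)) (hwo : gradient J wo = 0)
    (A : Matrix (Fin N) (Fin N) ℝ)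
    (hA0 : ∀ l k, 0 ≤ A l k) (hA1 : ∀ k, ∑ l, A l k = 1)
    (hAprim : ∃ m : ℕ, 1 ≤ m ∧ ∀ l k, 0 < (A ^ m) l k)
    (p : Fin N → ℝ) (hp : A *ᵥ p = p) (hppos : ∀ n, 0 < p n) (hpsum : ∑ n, p n = 1)
    (μs : ℕ → ℝ)
    (hμpos : ∀ i, 1 ≤ i → 0 < μs i)
    (α σv2 : ℝ) (hα : 0 ≤ α) (hσ : 0 < σv2)
    (w ψ v : ℕ → Fin N → Ω → EuclideanSpace ℝ (Fin M))
    (hadapt : ∀ k, Adapted ℱ fun i => w i k)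
    (hw0 : ∀ k, Integrable (fun ω => ‖w 0 k ω‖ ^ 2) P)
    (hupd1 : ∀ i k ω, 1 ≤ i →
      ψ i k ω = w (i - 1) k ω - μs i • (gradient J (w (i - 1) k ω) + v i k ω))
    (hupd2 : ∀ i k ω, 1 ≤ i → w i k ω = ∑ l, A l k • ψ i l ω)
    (hvint : ∀ i k, 1 ≤ i → Integrable (v i k) P ∧ Integrable (fun ω => ‖v i k ω‖ ^ 2) P)
    (hvmean : ∀ i k, 1 ≤ i → P[v i k | ℱ (i - 1)] =ᵐ[P] 0)
    (hvvar : ∀ i k, 1 ≤ i → ∀ᵐ ω ∂P,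
      (P[fun ω' => ‖v i k ω'‖ ^ 2 | ℱ (i - 1)]) ω ≤ α * ‖wo - w (i - 1) k ω‖ ^ 2 + σv2) :
    ∀ i, 1 ≤ i →
      P[fun ω => ∑ k, p k * ‖wo - w i k ω‖ ^ 2 | ℱ (i - 1)] ≤ᵐ[P]
      fun ω => (1 - 2 * μs i * lmin + (μs i) ^ 2 * (lmax ^ 2 + α)) *
          ∑ k, p k * ‖wo - w (i - 1) k ω‖ ^ 2 + (μs i) ^ 2 * σv2 := by
  obtain ⟨hgd, hsym⟩ := aux_grad J hJ
  have hlmax : 0 < lmax := hlmin.trans_le hlle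
  have hLip : ∀ x, ‖gradient J x‖ ≤ lmax * ‖wo - x‖ := by
    intro x
    have hb : ∀ y ∈ Set.univ, ‖fderiv ℝ (gradient J) y‖ ≤ lmax := fun y _ =>
      aux_opnorm _ lmax hlmax (hsym y)
        (fun u => le_trans (by positivity) (hHess y u).1) (fun u => (hHess y u).2)
    have := convex_univ.norm_image_sub_le_of_norm_fderiv_le (fun y _ => hgd y) hb
      (Set.mem_univ wo) (Set.mem_univ x)
    rwa [hwo, sub_zero, norm_sub_rev x wo] at this
  have hgc : Continuous (gradient J) := hgd.continuous
  have hcontr : ∀ (i : ℕ) (x), 1 ≤ i → ‖wo - x + μs i • gradient J x‖ ^ 2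
      ≤ (1 - 2 * μs i * lmin + (μs i) ^ 2 * lmax ^ 2) * ‖wo - x‖ ^ 2 := by
    intro i x hi
    have h1 := aux_mono (gradient J) hgd lmin (fun x v => (hHess x v).1) wo x
    rw [hwo, zero_sub, inner_neg_right] at h1
    have h2 : ‖gradient J x‖ ^ 2 ≤ (lmax * ‖wo - x‖) ^ 2 :=
      pow_le_pow_left₀ (norm_nonneg _) (hLip x) 2
    rw [norm_add_sq_real, inner_smul_right, norm_smul, mul_pow, Real.norm_eq_abs, sq_abs]
    have h3 := mul_le_mul_of_nonneg_left h2 (sq_nonneg (μs i))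
    have h4 := mul_le_mul_of_nonneg_left h1 (hμpos i hi).le
    nlinarith
  have hwm : ∀ i k, StronglyMeasurable[ℱ i] (w i k) := fun i k =>
    (hadapt k i).stronglyMeasurable
  have hwm0 : ∀ i k, AEStronglyMeasurable (w i k) P := fun i k =>
    ((hwm i k).mono (ℱ.le i)).aestronglyMeasurable
  have hv2 : ∀ i k, 1 ≤ i → MemLp (v i k) 2 P := fun i k hi =>
    (memLp_two_iff_integrable_sq_norm (hvint i k hi).1.aestronglyMeasurable).2 (hvint i k hi).2
  have hgL : ∀ i k, MemLp (w i k) 2 P → MemLp (fun ω => gradient J (w i k ω)) 2 P := by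
    intro i k h
    refine MemLp.of_le_mul (c := lmax) ((memLp_const wo).sub h)
      (hgc.comp_aestronglyMeasurable (hwm0 i k)) (ae_of_all _ fun ω => ?_)
    exact hLip _
  have hw2 : ∀ i k, MemLp (w i k) 2 P := by
    intro i
    induction i with
    | zero => exact fun k => (memLp_two_iff_integrable_sq_norm (hwm0 0 k)).2 (hw0 k)
    | succ n ih =>
      intro k
      have e : w (n + 1) k = fun ω => ∑ l, A l k •
          (w n l ω - μs (n + 1) • (gradient J (w n l ω) + v (n + 1) l ω)) := by
        funext ω
        rw [hupd2 (n + 1) k ω (by omega)]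
        exact Finset.sum_congr rfl fun l _ => by rw [hupd1 (n + 1) l ω (by omega)]; rfl
      rw [e]
      refine memLp_finsetSum _ fun l _ => ?_
      exact ((ih l).sub (((hgL n l (ih l)).add (hv2 (n + 1) l (by omega))).const_smul
        (μs (n + 1)))).const_smul (A l k)
  intro i hi
  let X : Fin N → Ω → EuclideanSpace ℝ (Fin M) := fun l ω =>
    wo - w (i - 1) l ω + μs i • gradient J (w (i - 1) l ω)
  have hXm : ∀ l, StronglyMeasurable[ℱ (i - 1)] (X l) := fun l =>
    (stronglyMeasurable_const.sub (hwm (i - 1) l)).add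
      ((hgc.comp_stronglyMeasurable (hwm (i - 1) l)).const_smul (μs i))
  have hX2 : ∀ l, MemLp (X l) 2 P := fun l =>
    ((memLp_const wo).sub (hw2 (i - 1) l)).add ((hgL _ l (hw2 (i - 1) l)).const_smul (μs i))
  have hI1 : ∀ l, Integrable (fun ω => ‖X l ω‖ ^ 2) P := fun l =>
    (memLp_two_iff_integrable_sq_norm (hX2 l).1).1 (hX2 l)
  have hI2 : ∀ l, Integrable (fun ω => ⟪X l ω, v i l ω⟫) P := by
    intro l
    refine Integrable.mono' ((hI1 l).add (hvint i l hi).2)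
      ((hX2 l).1.inner (hvint i l hi).1.aestronglyMeasurable) (ae_of_all _ fun ω => ?_)
    have h := norm_inner_le_norm (𝕜 := ℝ) (X l ω) (v i l ω)
    simp only [Pi.add_apply]
    nlinarith [sq_nonneg (‖X l ω‖ - ‖v i l ω‖), sq_nonneg ‖X l ω‖, sq_nonneg ‖v i l ω‖]
  have hI3 := fun l => (hvint i l hi).2
  have hIw : Integrable (fun ω => ∑ k, p k * ‖wo - w i k ω‖ ^ 2) P := by
    refine integrable_finsetSum _ fun k _ => Integrable.const_mul ?_ _
    have h := (memLp_const (μ := P) (p := 2) wo).sub (hw2 i k)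
    exact (memLp_two_iff_integrable_sq_norm h.1).1 h
  let G : Fin N → Ω → ℝ := fun l =>
    p l • ((fun ω => ‖X l ω‖ ^ 2) + ((2 * μs i) • (fun ω => ⟪X l ω, v i l ω⟫) +
      (μs i ^ 2) • fun ω => ‖v i l ω‖ ^ 2))
  have hGI : ∀ l, Integrable (G l) P := fun l =>
    ((hI1 l).add (((hI2 l).smul _).add ((hI3 l).smul _))).smul _
  have hle : (fun ω => ∑ k, p k * ‖wo - w i k ω‖ ^ 2) ≤ᵐ[P] ∑ l, G l := by
    refine ae_of_all _ fun ω => ?_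
    have hG : ∀ l, G l ω = p l * ‖wo - ψ i l ω‖ ^ 2 := by
      intro l
      have e : wo - ψ i l ω = X l ω + μs i • v i l ω := by
        rw [hupd1 i l ω hi]
        simp only [X, smul_add]
        abel
      rw [e, norm_add_sq_real, inner_smul_right, norm_smul, mul_pow, Real.norm_eq_abs, sq_abs]
      simp only [G, Pi.smul_apply, Pi.add_apply, smul_eq_mul]
      ring
    rw [Finset.sum_apply]
    simp only [hG]
    calc ∑ k, p k * ‖wo - w i k ω‖ ^ 2
        ≤ ∑ k, p k * ∑ l, A l k * ‖wo - ψ i l ω‖ ^ 2 := by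
          refine Finset.sum_le_sum fun k _ => mul_le_mul_of_nonneg_left ?_ (hppos k).le
          rw [hupd2 i k ω hi]
          exact aux_jensen (fun l => A l k) (fun l => hA0 l k) (hA1 k) wo _
      _ = ∑ l, (A *ᵥ p) l * ‖wo - ψ i l ω‖ ^ 2 := by
          simp only [Finset.mul_sum, Matrix.mulVec, dotProduct, Finset.sum_mul]
          rw [Finset.sum_comm]
          exact Finset.sum_congr rfl fun l _ => Finset.sum_congr rfl fun k _ => by ring
      _ = _ := by rw [hp]
  have hm := ℱ.le (i - 1)
  have hGb : ∀ l, P[G l | ℱ (i - 1)] ≤ᵐ[P] fun ω => p l *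
      ((1 - 2 * μs i * lmin + (μs i) ^ 2 * (lmax ^ 2 + α)) * ‖wo - w (i - 1) l ω‖ ^ 2
        + (μs i) ^ 2 * σv2) := by
    intro l
    have c0 := condExp_smul (μ := P) (p l) ((fun ω => ‖X l ω‖ ^ 2) +
      ((2 * μs i) • (fun ω => ⟪X l ω, v i l ω⟫) + (μs i ^ 2) • fun ω => ‖v i l ω‖ ^ 2)) (ℱ (i - 1))
    have c1 := condExp_add (hI1 l) (((hI2 l).smul (2 * μs i)).add ((hI3 l).smul (μs i ^ 2)))
      (ℱ (i - 1))
    have c2 := condExp_add ((hI2 l).smul (2 * μs i)) ((hI3 l).smul (μs i ^ 2)) (ℱ (i - 1))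
    have c3 := condExp_smul (μ := P) (2 * μs i) (fun ω => ⟪X l ω, v i l ω⟫) (ℱ (i - 1))
    have c4 := condExp_smul (μ := P) (μs i ^ 2) (fun ω => ‖v i l ω‖ ^ 2) (ℱ (i - 1))
    have c5 : P[fun ω => ‖X l ω‖ ^ 2 | ℱ (i - 1)] = fun ω => ‖X l ω‖ ^ 2 :=
      condExp_of_stronglyMeasurable hm ((hXm l).norm.pow 2) (hI1 l)
    have c6 := condExp_bilin_of_stronglyMeasurable_left (μ := P) (innerSL ℝ) (hXm l)
      (hI2 l) (hvint i l hi).1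
    filter_upwards [c0, c1, c2, c3, c4, c6, hvmean i l hi, hvvar i l hi] with ω
      d0 d1 d2 d3 d4 d6 d7 d8
    have d6' : (P[fun ω => ⟪X l ω, v i l ω⟫ | ℱ (i - 1)]) ω = 0 := by
      refine Eq.trans d6 ?_
      rw [d7]; simp
    refine d0.le.trans ?_
    simp only [Pi.smul_apply, smul_eq_mul]
    refine mul_le_mul_of_nonneg_left ?_ (hppos l).le
    rw [d1, Pi.add_apply, d2, Pi.add_apply, d3, d4, c5]
    simp only [Pi.smul_apply, smul_eq_mul, d6']
    have h1 := hcontr i (w (i - 1) l ω) hi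
    have h2 := mul_le_mul_of_nonneg_left d8 (sq_nonneg (μs i))
    simp only [X]
    linarith
  have hmono := condExp_mono (m := ℱ (i - 1)) hIw
    (integrable_finsetSum' Finset.univ fun l _ => hGI l) hle
  have hsum := condExp_finsetSum (s := Finset.univ) (fun l _ => hGI l) (ℱ (i - 1))
  filter_upwards [hmono, hsum, ae_all_iff.2 hGb] with ω e1 e2 e3
  refine e1.trans ?_
  rw [e2, Finset.sum_apply]
  refine (Finset.sum_le_sum fun l _ => e3 l).trans (le_of_eq ?_)
  simp only [mul_add, Finset.sum_add_distrib]
  rw [← Finset.sum_mul, hpsum, one_mul]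
  congr 1
  rw [Finset.mul_sum]
  exact Finset.sum_congr rfl fun l _ => by ring
end
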